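/- arXiv:math/0009176 — 3 statements merged into one kernel-verified Lean document; each statement's English description precedes it below -/
import Mathlib

section
/- Let ω ∈ ℝ^n satisfy (H1) and let f : T^n → ℝ be given by an absolutely convergent Fourier series f(φ) = Σ_{k∈ℤ^n} f_k e^{i k·φ}. Then the Poincaré–Melnikov primitive Γ(A) = ∫_ℝ (1 − cos(q_0(t)))·f(ωt + A) dt is well defined for every A ∈ T^n, and its Fourier coefficients Γ_k (so that Γ(A) = Σ_{k∈ℤ^n} Γ_k e^{i k·A}) are given explicitly by Γ_k = f_k · 2π(k·ω) / sinh((k·ω)·π/2) for every k ≠ 0, and Γ_0 = 4 f_0. -/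
open Real MeasureTheory

/-- The unperturbed pendulum separatrix `q₀(t) = 4 arctan(eᵗ)`. -/
noncomputable def q0 (t : ℝ) : ℝ := 4 * Real.arctan (Real.exp t)

theorem one_sub_cos_q0 (t : ℝ) :
    1 - Real.cos (q0 t) = 8 * (Real.sigmoid (2 * t) * (1 - Real.sigmoid (2 * t))) := by
  have h4 : q0 t = 2 * (2 * Real.arctan (Real.exp t)) := by unfold q0; ring
  have he : Real.exp t ^ 2 = Real.exp (2 * t) := by rw [← Real.exp_nat_mul]; norm_num
  rw [h4, Real.cos_two_mul, Real.cos_two_mul, Real.cos_sq_arctan, he, Real.sigmoid_def,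
    Real.exp_neg]
  have hp := Real.exp_pos (2 * t)
  field_simp
  ring

theorem hasDerivAt_sig2 (t : ℝ) : HasDerivAt (fun t : ℝ => Real.sigmoid (2 * t))
    (2 * (Real.sigmoid (2 * t) * (1 - Real.sigmoid (2 * t)))) t := by
  have h1 : HasDerivAt (fun t : ℝ => 2 * t) 2 t := by
    simpa using (hasDerivAt_id t).const_mul (2 : ℝ)
  have h2 := (Real.hasDerivAt_sigmoid (2 * t)).comp t h1
  rw [mul_comm]
  exact h2

theorem sig2_pos (t : ℝ) : 0 < Real.sigmoid (2 * t) * (1 - Real.sigmoid (2 * t)) :=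
  mul_pos (Real.sigmoid_pos _) (sub_pos.2 (Real.sigmoid_lt_one _))

theorem sig2_inj : Function.Injective (fun t : ℝ => Real.sigmoid (2 * t)) := by
  intro a b h
  have := Real.sigmoid_injective h
  linarith

theorem sig2_image : (fun t : ℝ => Real.sigmoid (2 * t)) '' Set.univ = Set.Ioo 0 1 := by
  rw [Set.image_univ, ← Real.range_sigmoid]
  ext x
  constructor
  · rintro ⟨t, rfl⟩
    exact ⟨2 * t, rfl⟩
  · rintro ⟨t, rfl⟩
    exact ⟨t / 2, by simp only []; congr 1; ring⟩

theorem integrable_weight : Integrable (fun t : ℝ => 1 - Real.cos (q0 t)) := by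
  have h := (integrableOn_image_iff_integrableOn_abs_deriv_smul (s := Set.univ)
    MeasurableSet.univ (fun x _ => (hasDerivAt_sig2 x).hasDerivWithinAt)
    sig2_inj.injOn (fun _ => (4 : ℝ))).1 (by
      rw [sig2_image]
      exact integrableOn_const (by simp) )
  rw [integrableOn_univ] at h
  refine h.congr (Filter.Eventually.of_forall fun t => ?_)
  have := sig2_pos t
  simp only [smul_eq_mul]
  rw [abs_of_pos (by linarith), one_sub_cos_q0]
  ring

theorem integral_weight_exp (s : ℝ) :
    ∫ t : ℝ, ((1 - Real.cos (q0 t) : ℝ) : ℂ) * Complex.exp (Complex.I * ((s * t : ℝ) : ℂ)) =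
      4 * (Complex.Gamma (1 + Complex.I * s / 2) * Complex.Gamma (1 - Complex.I * s / 2)) := by
  rw [Complex.Gamma_mul_Gamma_eq_betaIntegral (by simp) (by simp)]
  have h2 : (1 + Complex.I * s / 2) + (1 - Complex.I * s / 2) = (1 : ℂ) + 1 := by ring
  rw [h2, Complex.Gamma_add_one _ one_ne_zero, Complex.Gamma_one, one_mul, one_mul]
  unfold Complex.betaIntegral
  rw [intervalIntegral.integral_of_le zero_le_one, integral_Ioc_eq_integral_Ioo, ← sig2_image,
    integral_image_eq_integral_abs_deriv_smul MeasurableSet.univ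
      (fun x _ => (hasDerivAt_sig2 x).hasDerivWithinAt) sig2_inj.injOn, setIntegral_univ,
    ← integral_const_mul]
  congr 1
  ext t
  have hp := sig2_pos t
  have h0 := Real.sigmoid_pos (2 * t)
  have h1 : 0 < 1 - Real.sigmoid (2 * t) := sub_pos.2 (Real.sigmoid_lt_one _)
  have hlog : Real.log (1 - Real.sigmoid (2 * t)) = Real.log (Real.sigmoid (2 * t)) - 2 * t := by
    rw [← Real.sigmoid_neg, ← Real.sigmoid_mul_rexp_neg, Real.log_mul h0.ne' (Real.exp_ne_zero _),
      Real.log_exp]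
    ring
  rw [one_sub_cos_q0, abs_of_pos (by linarith)]
  have e1 : (1 - (Real.sigmoid (2 * t) : ℂ)) = ((1 - Real.sigmoid (2 * t) : ℝ) : ℂ) := by
    push_cast; ring
  rw [e1, Complex.cpow_def_of_ne_zero (by exact_mod_cast h0.ne'),
    Complex.cpow_def_of_ne_zero (by exact_mod_cast h1.ne'), ← Complex.ofReal_log h0.le,
    ← Complex.ofReal_log h1.le, hlog, ← Complex.exp_add, Complex.real_smul]
  have e2 : (Complex.I * ((s * t : ℝ) : ℂ)) =
      (Real.log (Real.sigmoid (2 * t)) : ℂ) * (1 + Complex.I * s / 2 - 1) +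
      ((Real.log (Real.sigmoid (2 * t)) - 2 * t : ℝ) : ℂ) * (1 - Complex.I * s / 2 - 1) := by
    push_cast; ring
  rw [e2]
  push_cast
  ring

theorem gamma_formula (s : ℝ) (hs : s ≠ 0) :
    4 * (Complex.Gamma (1 + Complex.I * s / 2) * Complex.Gamma (1 - Complex.I * s / 2)) =
      ((2 * Real.pi * s : ℝ) : ℂ) / ((Real.sinh (s * Real.pi / 2) : ℝ) : ℂ) := by
  have hz : Complex.I * s / 2 ≠ 0 := by
    simp [hs, Complex.I_ne_zero]
  rw [add_comm, Complex.Gamma_add_one _ hz, mul_assoc, Complex.Gamma_mul_Gamma_one_sub]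
  have e : (Real.pi : ℂ) * (Complex.I * s / 2) = ((s * Real.pi / 2 : ℝ) : ℂ) * Complex.I := by
    push_cast; ring
  rw [e, Complex.sin_mul_I, ← Complex.ofReal_sinh]
  have hsh : ((Real.sinh (s * Real.pi / 2) : ℝ) : ℂ) ≠ 0 := by
    have : s * Real.pi / 2 ≠ 0 := by
      have := Real.pi_ne_zero
      positivity
    exact_mod_cast (Real.sinh_ne_zero.2 this)
  have hI := Complex.I_ne_zero
  generalize ((Real.sinh (s * Real.pi / 2) : ℝ) : ℂ) = S at *
  push_cast
  field_simp
  ring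

/-- Assume the diophantine condition (H1) on `ω` and let `f` be given by an absolutely
convergent Fourier series with coefficients `c k`.  Then the Poincaré–Melnikov primitive
`Γ(A) = ∫_ℝ (1 - cos q₀(t)) f(ωt + A) dt` is well defined, and its Fourier coefficients
are `Γ_k = c_k · 2π(k·ω)/sinh((k·ω)π/2)` for `k ≠ 0`, and `Γ_0 = 4 c_0`. -/
theorem melnikov_fourier_coefficients
    (n : ℕ) (hn : 0 < n) (ω : Fin n → ℝ) (γ τ : ℝ) (hγ : 0 < γ) (hτ : (n : ℝ) < τ)
    (hH1 : ∀ k : Fin n → ℤ, k ≠ 0 →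
      γ / ‖(fun i => (k i : ℝ))‖ ^ τ ≤ |∑ i, (k i : ℝ) * ω i|)
    (c : (Fin n → ℤ) → ℂ) (hc : Summable fun k => ‖c k‖)
    (f : (Fin n → ℝ) → ℝ)
    (hf : ∀ A : Fin n → ℝ,
      ((f A : ℝ) : ℂ) = ∑' k : Fin n → ℤ,
        c k * Complex.exp (Complex.I * ((∑ i, (k i : ℝ) * A i : ℝ) : ℂ))) :
    (∀ A : Fin n → ℝ,
      Integrable (fun t : ℝ => (1 - Real.cos (q0 t)) * f (fun i => ω i * t + A i))) ∧
    ∃ Γk : (Fin n → ℤ) → ℂ,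
      (∀ A : Fin n → ℝ,
        (((∫ t : ℝ, (1 - Real.cos (q0 t)) * f (fun i => ω i * t + A i)) : ℝ) : ℂ)
          = ∑' k : Fin n → ℤ,
              Γk k * Complex.exp (Complex.I * ((∑ i, (k i : ℝ) * A i : ℝ) : ℂ))) ∧
      (∀ k : Fin n → ℤ, k ≠ 0 →
        Γk k = c k * ((2 * Real.pi * (∑ i, (k i : ℝ) * ω i) : ℝ) : ℂ) /
          ((Real.sinh ((∑ i, (k i : ℝ) * ω i) * Real.pi / 2) : ℝ) : ℂ)) ∧
      Γk 0 = 4 * c 0 := by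
  classical
  have hnorm : ∀ x : ℝ, ‖Complex.exp (Complex.I * (x : ℂ))‖ = 1 := fun x => by
    rw [mul_comm]; exact Complex.norm_exp_ofReal_mul_I x
  have hW0 : ∀ t, 0 ≤ 1 - Real.cos (q0 t) := fun t => sub_nonneg.2 (Real.cos_le_one _)
  have hcont : Continuous f := by
    have h1 : Continuous fun A : Fin n → ℝ => ∑' k : Fin n → ℤ,
        c k * Complex.exp (Complex.I * ((∑ i, (k i : ℝ) * A i : ℝ) : ℂ)) := by
      refine continuous_tsum (fun k => ?_) hc (fun k A => ?_)
      · fun_prop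
      · rw [norm_mul, hnorm, mul_one]
    have h2 := Complex.continuous_re.comp h1
    refine h2.congr fun A => ?_
    simp only [Function.comp]
    rw [← hf A, Complex.ofReal_re]
  have hbd : ∀ A, ‖f A‖ ≤ ∑' k, ‖c k‖ := fun A => by
    rw [← Complex.norm_real, hf A]
    refine tsum_of_norm_bounded hc.hasSum fun k => ?_
    rw [norm_mul, hnorm, mul_one]
  have hIntegr : ∀ A : Fin n → ℝ,
      Integrable (fun t : ℝ => (1 - Real.cos (q0 t)) * f (fun i => ω i * t + A i)) := fun A => by
    refine integrable_weight.mul_bdd (c := ∑' k, ‖c k‖) ?_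
      (Filter.Eventually.of_forall fun t => hbd _)
    exact (hcont.comp (by fun_prop)).aestronglyMeasurable
  refine ⟨hIntegr, fun k => c k * (4 * (Complex.Gamma (1 + Complex.I * (∑ i, (k i : ℝ) * ω i : ℝ) / 2)
    * Complex.Gamma (1 - Complex.I * (∑ i, (k i : ℝ) * ω i : ℝ) / 2))), fun A => ?_,
    fun k hk => ?_, ?_⟩
  · have hsplit : ∀ (k : Fin n → ℤ) (t : ℝ),
        Complex.exp (Complex.I * ((∑ i, (k i : ℝ) * (ω i * t + A i) : ℝ) : ℂ)) =
        Complex.exp (Complex.I * (((∑ i, (k i : ℝ) * ω i) * t : ℝ) : ℂ)) *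
        Complex.exp (Complex.I * ((∑ i, (k i : ℝ) * A i : ℝ) : ℂ)) := fun k t => by
      rw [← Complex.exp_add, ← mul_add, ← Complex.ofReal_add]
      congr 3
      rw [Finset.sum_mul, ← Finset.sum_add_distrib]
      exact Finset.sum_congr rfl fun i _ => by ring
    let F : (Fin n → ℤ) → ℝ → ℂ := fun k t => ((1 - Real.cos (q0 t) : ℝ) : ℂ) *
      (c k * Complex.exp (Complex.I * ((∑ i, (k i : ℝ) * (ω i * t + A i) : ℝ) : ℂ)))
    have hFn : ∀ k t, ‖F k t‖ = (1 - Real.cos (q0 t)) * ‖c k‖ := fun k t => by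
      simp only [F]
      rw [norm_mul, norm_mul, hnorm, mul_one, Complex.norm_real, Real.norm_of_nonneg (hW0 t)]
    have hFi : ∀ k, Integrable (F k) := fun k => by
      refine integrable_weight.ofReal.mul_bdd (c := ‖c k‖) ?_
        (Filter.Eventually.of_forall fun t => ?_)
      · exact Continuous.aestronglyMeasurable (by fun_prop)
      · rw [norm_mul, hnorm, mul_one]
    have hFs : Summable fun k => ∫ t, ‖F k t‖ := by
      simp_rw [hFn, integral_mul_const]
      exact hc.mul_left _
    have key := (hasSum_integral_of_summable_integral_norm hFi hFs).tsum_eq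
    rw [← integral_complex_ofReal]
    calc _ = ∫ t, ∑' k, F k t := by
          refine integral_congr_ae (Filter.Eventually.of_forall fun t => ?_)
          simp only [F]
          rw [tsum_mul_left, Complex.ofReal_mul, hf]
      _ = _ := by
          rw [← key]
          refine tsum_congr fun k => ?_
          beta_reduce
          rw [← integral_weight_exp, ← integral_const_mul, ← integral_mul_const]
          refine integral_congr_ae (Filter.Eventually.of_forall fun t => ?_)
          simp only [F]
          rw [hsplit]
          ring
  · have hs : (∑ i, (k i : ℝ) * ω i) ≠ 0 := by
      have hk' : (fun i => (k i : ℝ)) ≠ 0 := fun h => hk (by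
        ext i
        have := congrFun h i
        simpa using this)
      have h1 : 0 < γ / ‖(fun i => (k i : ℝ))‖ ^ τ :=
        div_pos hγ (Real.rpow_pos_of_pos (norm_pos_iff.2 hk') _)
      exact abs_pos.1 (h1.trans_le (hH1 k hk))
    simp only []
    rw [gamma_formula _ hs, ← mul_div_assoc]
  · simp [Complex.Gamma_one, mul_comm]
end

section
/- Let ω ∈ ℝ^n and let f : T^n → ℝ be continuous (identified with a ℤ^n-periodic continuous function on ℝ^n). There exist μ_0 > 0 and C > 0, depending only on sup|f|, such that for every μ with |μ| < μ_0 and every A ∈ ℝ^n, θ ∈ ℝ, there is a unique continuous function q : ℝ → ℝ with sup_{t∈ℝ} |q(t) − q_θ(t)| ≤ C|μ| satisfying: q is C² on (−∞,θ) and on (θ,+∞) and solves −q̈(t) + sin(q(t)) = μ·sin(q(t))·f(ωt + A) there; q(θ) = π; q(t) → 0 as t → −∞; and q(t) → 2π as t → +∞. -/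
open Real Filter

/-- `q` is a 1-bump pseudo-heteroclinic solution of the quasi-periodically forced
pendulum `-q̈ + sin q = μ sin q · f(ωt + A)`, at distance at most `C|μ|` from the
translated separatrix `q_θ`: it is continuous on `ℝ`, twice differentiable and solves
the equation on `(-∞,θ)` and `(θ,+∞)`, is glued at `q(θ) = π`, and is asymptotic to
`0` at `-∞` and to `2π` at `+∞`. -/
def IsPseudoHet (n : ℕ) (ω : Fin n → ℝ) (f : (Fin n → ℝ) → ℝ) (μ : ℝ)
    (A : Fin n → ℝ) (θ : ℝ) (C : ℝ) (q : ℝ → ℝ) : Prop :=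
  Continuous q ∧
  (∀ t : ℝ, |q t - q0 (t - θ)| ≤ C * |μ|) ∧
  (∀ t : ℝ, t ≠ θ →
    HasDerivAt q (deriv q t) t ∧
    HasDerivAt (deriv q)
      (Real.sin (q t) - μ * Real.sin (q t) * f (fun i => ω i * t + A i)) t) ∧
  q θ = Real.pi ∧
  Tendsto q atBot (nhds 0) ∧
  Tendsto q atTop (nhds (2 * Real.pi))

lemma q0_eq_cosh_aux (s : ℝ) : Real.cosh s = (Real.exp s ^ 2 + 1) / (2 * Real.exp s) := by
  rw [Real.cosh_eq, Real.exp_neg]; have := Real.exp_pos s; field_simp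

lemma q0_eq_sinh_aux (s : ℝ) : Real.sinh s = (Real.exp s ^ 2 - 1) / (2 * Real.exp s) := by
  rw [Real.sinh_eq, Real.exp_neg]; have := Real.exp_pos s; field_simp

lemma sin_two_arctan_exp (s : ℝ) : Real.sin (2 * Real.arctan (Real.exp s)) = 1 / Real.cosh s := by
  rw [Real.sin_two_mul, Real.sin_arctan, Real.cos_arctan, q0_eq_cosh_aux]
  have h := Real.exp_pos s
  have h2 : 0 < 1 + Real.exp s ^ 2 := by positivity
  have h3 := Real.sq_sqrt h2.le
  have h4 := Real.sqrt_pos.2 h2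
  field_simp
  rw [h3]; ring

lemma cos_two_arctan_exp (s : ℝ) :
    Real.cos (2 * Real.arctan (Real.exp s)) = - Real.sinh s / Real.cosh s := by
  rw [Real.cos_two_mul, Real.cos_arctan, q0_eq_cosh_aux, q0_eq_sinh_aux]
  have h := Real.exp_pos s
  have h2 : 0 < 1 + Real.exp s ^ 2 := by positivity
  have h3 := Real.sq_sqrt h2.le
  have h4 := Real.sqrt_pos.2 h2
  rw [div_pow, h3]
  have h5 : 0 < Real.exp s ^ 2 + 1 := by positivity
  field_simp
  ring

lemma sin_q0 (s : ℝ) : Real.sin (q0 s) = -2 * Real.sinh s / Real.cosh s ^ 2 := by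
  have : q0 s = 2 * (2 * Real.arctan (Real.exp s)) := by unfold q0; ring
  rw [this, Real.sin_two_mul, sin_two_arctan_exp, cos_two_arctan_exp]
  have := Real.cosh_pos s
  field_simp

lemma cos_q0 (s : ℝ) : Real.cos (q0 s) = 1 - 2 / Real.cosh s ^ 2 := by
  have : q0 s = 2 * (2 * Real.arctan (Real.exp s)) := by unfold q0; ring
  rw [this, Real.cos_two_mul, cos_two_arctan_exp]
  have := Real.cosh_pos s
  have h := Real.cosh_sq s
  field_simp
  rw [h]; ring

lemma q0_hasDerivAt (s : ℝ) : HasDerivAt q0 (2 / Real.cosh s) s := by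
  have h := ((Real.hasDerivAt_exp s).arctan).const_mul 4
  refine h.congr_deriv ?_
  rw [q0_eq_cosh_aux]
  have h := Real.exp_pos s
  have h5 : 0 < Real.exp s ^ 2 + 1 := by positivity
  have h2 : 0 < 1 + Real.exp s ^ 2 := by positivity
  field_simp
  ring

lemma q0_hasDerivAt2 (s : ℝ) :
    HasDerivAt (fun s => 2 / Real.cosh s) (Real.sin (q0 s)) s := by
  have h := (hasDerivAt_const s (2:ℝ)).div (Real.hasDerivAt_cosh s) (Real.cosh_pos s).ne'
  refine h.congr_deriv ?_
  rw [sin_q0]; ring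

lemma q0_continuous : Continuous q0 :=
  continuous_iff_continuousAt.2 fun s => (q0_hasDerivAt s).continuousAt

lemma q0_zero : q0 0 = Real.pi := by
  unfold q0; rw [Real.exp_zero, Real.arctan_one]; ring

lemma q0_neg (s : ℝ) : q0 (-s) = 2 * Real.pi - q0 s := by
  unfold q0; rw [Real.exp_neg, Real.arctan_inv_of_pos (Real.exp_pos s)]; ring

lemma q0_tendsto : Tendsto q0 atTop (nhds (2 * Real.pi)) := by
  have h := ((Real.tendsto_arctan_atTop.mono_right nhdsWithin_le_nhds).comp
    Real.tendsto_exp_atTop).const_mul 4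
  rw [show (4:ℝ) * (Real.pi / 2) = 2 * Real.pi by ring] at h
  exact h

lemma exp_le_two_cosh (s : ℝ) : Real.exp s ≤ 2 * Real.cosh s := by
  rw [Real.cosh_eq]; have := Real.exp_pos (-s); linarith

lemma cosh_le_exp {s : ℝ} (hs : 0 ≤ s) : Real.cosh s ≤ Real.exp s := by
  rw [Real.cosh_eq]
  have : Real.exp (-s) ≤ Real.exp s := Real.exp_le_exp.2 (by linarith)
  linarith

lemma one_div_cosh_le (s : ℝ) : 1 / Real.cosh s ≤ 2 * Real.exp (-s) := by
  rw [div_le_iff₀ (Real.cosh_pos s), Real.exp_neg]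
  have := exp_le_two_cosh s
  have h := Real.exp_pos s
  field_simp
  linarith

lemma abs_sin_q0_le {s : ℝ} : |Real.sin (q0 s)| ≤ 4 * Real.exp (-s) := by
  have h1 := one_div_cosh_le s
  have h2 := Real.cosh_pos s
  have h3 : |Real.sinh s| ≤ Real.cosh s := by
    apply abs_le_of_sq_le_sq _ h2.le
    rw [Real.cosh_sq]; linarith
  rw [sin_q0, abs_div, abs_mul, abs_of_pos (pow_pos h2 2)]
  calc |(-2:ℝ)| * |Real.sinh s| / Real.cosh s ^ 2 ≤ 2 * Real.cosh s / Real.cosh s ^ 2 := by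
        rw [abs_neg, abs_two]; gcongr
    _ = 2 * (1 / Real.cosh s) := by field_simp
    _ ≤ _ := by linarith

/-- Perturbation nonlinearity bound. -/
lemma sin_quad_lip (c r x y : ℝ) (hx : |x| ≤ r) (hy : |y| ≤ r) :
    |(Real.sin (c + x) - Real.cos c * x) - (Real.sin (c + y) - Real.cos c * y)| ≤ r * |x - y| := by
  have hd : ∀ z : ℝ, HasDerivAt (fun z => Real.sin (c + z) - Real.cos c * z)
      (Real.cos (c + z) - Real.cos c) z := by
    intro z
    have h1 := ((hasDerivAt_id z).const_add c).sin
    have h2 := (hasDerivAt_id z).const_mul (Real.cos c)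
    refine (h1.sub h2).congr_deriv ?_
    simp
  have := (convex_Icc (-r) r).norm_image_sub_le_of_norm_hasDerivWithin_le (C := r)
    (fun z _ => (hd z).hasDerivWithinAt) (fun z hz => ?_) (abs_le.1 hy) (abs_le.1 hx)
  · simpa [Real.norm_eq_abs] using this
  · have h := Real.abs_cos_sub_cos_le (c + z) c
    rw [Real.norm_eq_abs]
    have h' := abs_le.2 hz
    simp at h
    linarith


/-- Inner Green integral `∫_σ^∞ h / cosh`. -/
noncomputable def greenJ (h : ℝ → ℝ) (s : ℝ) : ℝ :=
  (∫ x in Set.Ioi (0:ℝ), h x / Real.cosh x) - ∫ x in (0:ℝ)..s, h x / Real.cosh x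

/-- Outer Green integral. -/
noncomputable def greenV (h : ℝ → ℝ) (s : ℝ) : ℝ :=
  ∫ x in (0:ℝ)..s, Real.cosh x ^ 2 * greenJ h x

/-- Green operator of the linearised pendulum on the half line. -/
noncomputable def greenG (h : ℝ → ℝ) (s : ℝ) : ℝ := - (greenV h s / Real.cosh s)

/-- Derivative of `greenG`. -/
noncomputable def greenG' (h : ℝ → ℝ) (s : ℝ) : ℝ :=
  Real.sinh s / Real.cosh s ^ 2 * greenV h s - Real.cosh s * greenJ h s

lemma continuous_div_cosh {h : ℝ → ℝ} (hc : Continuous h) :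
    Continuous fun x => h x / Real.cosh x :=
  hc.div Real.continuous_cosh fun x => (Real.cosh_pos x).ne'

lemma greenJ_hasDerivAt {h : ℝ → ℝ} (hc : Continuous h) (s : ℝ) :
    HasDerivAt (greenJ h) (-(h s / Real.cosh s)) s := by
  have := intervalIntegral.integral_hasDerivAt_right
    ((continuous_div_cosh hc).intervalIntegrable 0 s)
    ((continuous_div_cosh hc).stronglyMeasurableAtFilter _ _) (continuous_div_cosh hc).continuousAt
  exact this.const_sub _

lemma greenJ_continuous {h : ℝ → ℝ} (hc : Continuous h) : Continuous (greenJ h) :=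
  continuous_iff_continuousAt.2 fun s => (greenJ_hasDerivAt hc s).continuousAt

lemma greenV_hasDerivAt {h : ℝ → ℝ} (hc : Continuous h) (s : ℝ) :
    HasDerivAt (greenV h) (Real.cosh s ^ 2 * greenJ h s) s := by
  have h2 : Continuous fun x => Real.cosh x ^ 2 * greenJ h x :=
    (Real.continuous_cosh.pow 2).mul (greenJ_continuous hc)
  exact intervalIntegral.integral_hasDerivAt_right (h2.intervalIntegrable 0 s)
    (h2.stronglyMeasurableAtFilter _ _) h2.continuousAt

lemma greenG_hasDerivAt {h : ℝ → ℝ} (hc : Continuous h) (s : ℝ) :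
    HasDerivAt (greenG h) (greenG' h s) s := by
  have hp := Real.cosh_pos s
  refine ((greenV_hasDerivAt hc s).div (Real.hasDerivAt_cosh s) hp.ne').neg.congr_deriv ?_
  unfold greenG'
  field_simp
  ring

lemma greenG'_hasDerivAt {h : ℝ → ℝ} (hc : Continuous h) (s : ℝ) :
    HasDerivAt (greenG' h) (Real.cos (q0 s) * greenG h s + h s) s := by
  have hp := Real.cosh_pos s
  have h1 := ((Real.hasDerivAt_sinh s).div ((Real.hasDerivAt_cosh s).pow 2) (pow_ne_zero 2 hp.ne')).mul
    (greenV_hasDerivAt hc s)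
  have h2 := (Real.hasDerivAt_cosh s).mul (greenJ_hasDerivAt hc s)
  refine (h1.sub h2).congr_deriv ?_
  rw [cos_q0]
  unfold greenG
  have h3 := Real.sinh_sq s
  simp
  field_simp
  ring_nf
  rw [h3]; ring

lemma greenG_continuous {h : ℝ → ℝ} (hc : Continuous h) : Continuous (greenG h) :=
  continuous_iff_continuousAt.2 fun s => (greenG_hasDerivAt hc s).continuousAt

lemma greenG_zero (h : ℝ → ℝ) : greenG h 0 = 0 := by simp [greenG, greenV]

lemma div_cosh_bound {h : ℝ → ℝ} {M a : ℝ} (hM : 0 ≤ M)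
    (hb : ∀ s, 0 ≤ s → |h s| ≤ M * Real.exp (-a * s)) (x : ℝ) (hx : 0 ≤ x) :
    ‖h x / Real.cosh x‖ ≤ 2 * M * Real.exp (-(1 + a) * x) := by
  have hp := Real.cosh_pos x
  rw [Real.norm_eq_abs, abs_div, abs_of_pos hp]
  calc |h x| / Real.cosh x = |h x| * (1 / Real.cosh x) := by ring
    _ ≤ (M * Real.exp (-a * x)) * (2 * Real.exp (-x)) :=
        mul_le_mul (hb x hx) (one_div_cosh_le x) (by positivity) (by positivity)
    _ = 2 * M * (Real.exp (-a * x) * Real.exp (-x)) := by ring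
    _ = _ := by rw [← Real.exp_add]; ring_nf

lemma div_cosh_integrable {h : ℝ → ℝ} (hc : Continuous h) {M a : ℝ} (hM : 0 ≤ M) (ha : 0 ≤ a)
    (hb : ∀ s, 0 ≤ s → |h s| ≤ M * Real.exp (-a * s)) {s : ℝ} (hs : 0 ≤ s) :
    MeasureTheory.IntegrableOn (fun x => h x / Real.cosh x) (Set.Ioi s) := by
  refine MeasureTheory.Integrable.mono'
    ((integrableOn_exp_mul_Ioi (a := -(1 + a)) (by linarith) s).const_mul (2 * M))
    (continuous_div_cosh hc).aestronglyMeasurable ?_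
  refine (MeasureTheory.ae_restrict_iff' measurableSet_Ioi).2 (Eventually.of_forall fun x hx => ?_)
  exact div_cosh_bound hM hb x (hs.trans (le_of_lt hx))

lemma greenJ_bound {h : ℝ → ℝ} (hc : Continuous h) {M a : ℝ} (hM : 0 ≤ M) (ha : 0 ≤ a)
    (hb : ∀ s, 0 ≤ s → |h s| ≤ M * Real.exp (-a * s)) {s : ℝ} (hs : 0 ≤ s) :
    |greenJ h s| ≤ 2 * M * Real.exp (-(1 + a) * s) := by
  have hJ : greenJ h s = ∫ x in Set.Ioi s, h x / Real.cosh x := by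
    unfold greenJ
    rw [← intervalIntegral.integral_Ioi_sub_Ioi (div_cosh_integrable hc hM ha hb le_rfl) hs]
    ring
  rw [hJ, ← Real.norm_eq_abs]
  refine (MeasureTheory.norm_integral_le_of_norm_le
    ((integrableOn_exp_mul_Ioi (a := -(1 + a)) (by linarith) s).const_mul (2 * M))
    ((MeasureTheory.ae_restrict_iff' measurableSet_Ioi).2
      (Eventually.of_forall fun x hx => div_cosh_bound hM hb x (hs.trans (le_of_lt hx))))).trans ?_
  rw [MeasureTheory.integral_const_mul, integral_exp_mul_Ioi (by linarith)]
  refine mul_le_mul_of_nonneg_left ?_ (by positivity)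
  rw [neg_div_neg_eq]
  exact div_le_self (Real.exp_pos _).le (by linarith)

lemma greenG_bound {h : ℝ → ℝ} (hc : Continuous h) {M a : ℝ} (hM : 0 ≤ M) (ha : 0 ≤ a)
    (ha2 : a ≤ 1 / 2)
    (hb : ∀ s, 0 ≤ s → |h s| ≤ M * Real.exp (-a * s)) {s : ℝ} (hs : 0 ≤ s) :
    |greenG h s| ≤ 8 * M * Real.exp (-a * s) := by
  have hV : |greenV h s| ≤ 4 * M * Real.exp ((1 - a) * s) := by
    have hd : ∀ x : ℝ, HasDerivAt (fun x => 2 * M / (1 - a) * Real.exp ((1 - a) * x))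
        (2 * M * Real.exp ((1 - a) * x)) x := by
      intro x
      refine (((hasDerivAt_id x).const_mul (1 - a)).exp.const_mul (2 * M / (1 - a))).congr_deriv ?_
      have : 1 - a ≠ 0 := by linarith
      simp
      field_simp
    have hcont : Continuous fun x : ℝ => 2 * M * Real.exp ((1 - a) * x) := by fun_prop
    have h1 := intervalIntegral.norm_integral_le_of_norm_le (μ := MeasureTheory.volume)
      (f := fun x => Real.cosh x ^ 2 * greenJ h x) (g := fun x => 2 * M * Real.exp ((1 - a) * x))
      hs (Eventually.of_forall fun x hx => ?_) (hcont.intervalIntegrable _ _)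
    · rw [intervalIntegral.integral_eq_sub_of_hasDerivAt (fun x _ => hd x)
        (hcont.intervalIntegrable _ _)] at h1
      refine h1.trans ?_
      have h2 : 2 * M / (1 - a) ≤ 4 * M := by
        rw [div_le_iff₀ (by linarith)]; nlinarith
      have h3 : 0 ≤ 2 * M / (1 - a) := div_nonneg (by linarith) (by linarith)
      have h4 := mul_le_mul_of_nonneg_right h2 (Real.exp_pos ((1 - a) * s)).le
      simp only [mul_zero, Real.exp_zero]
      linarith
    · have hx0 : 0 ≤ x := hx.1.le
      rw [Real.norm_eq_abs, abs_mul, abs_of_nonneg (by positivity)]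
      have hcs := Real.cosh_pos x
      calc Real.cosh x ^ 2 * |greenJ h x|
          ≤ Real.exp x ^ 2 * (2 * M * Real.exp (-(1 + a) * x)) :=
            mul_le_mul (pow_le_pow_left₀ hcs.le (cosh_le_exp hx0) 2)
              (greenJ_bound hc hM ha hb hx0) (abs_nonneg _) (by positivity)
        _ = 2 * M * (Real.exp x * Real.exp x * Real.exp (-(1 + a) * x)) := by ring
        _ = _ := by rw [← Real.exp_add, ← Real.exp_add]; ring_nf
  have hp := Real.cosh_pos s
  unfold greenG
  rw [abs_neg, abs_div, abs_of_pos hp]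
  calc |greenV h s| / Real.cosh s = |greenV h s| * (1 / Real.cosh s) := by ring
    _ ≤ (4 * M * Real.exp ((1 - a) * s)) * (2 * Real.exp (-s)) :=
        mul_le_mul hV (one_div_cosh_le s) (by positivity) (by positivity)
    _ = 8 * M * (Real.exp ((1 - a) * s) * Real.exp (-s)) := by ring
    _ = _ := by rw [← Real.exp_add]; ring_nf

lemma greenG_sub {h k : ℝ → ℝ} (hc : Continuous h) (kc : Continuous k)
    (hi : MeasureTheory.IntegrableOn (fun x => h x / Real.cosh x) (Set.Ioi 0))
    (ki : MeasureTheory.IntegrableOn (fun x => k x / Real.cosh x) (Set.Ioi 0)) (s : ℝ) :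
    greenG (fun x => h x - k x) s = greenG h s - greenG k s := by
  have hJ : ∀ s, greenJ (fun x => h x - k x) s = greenJ h s - greenJ k s := by
    intro s
    unfold greenJ
    simp only [sub_div]
    rw [MeasureTheory.integral_sub hi ki, intervalIntegral.integral_sub
      ((continuous_div_cosh hc).intervalIntegrable _ _)
      ((continuous_div_cosh kc).intervalIntegrable _ _)]
    ring
  have hV : greenV (fun x => h x - k x) s = greenV h s - greenV k s := by
    unfold greenV
    simp only [hJ, mul_sub]
    refine intervalIntegral.integral_sub (Continuous.intervalIntegrable ?_ _ _)
      (Continuous.intervalIntegrable ?_ _ _)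
    · exact (Real.continuous_cosh.pow 2).mul (greenJ_continuous hc)
    · exact (Real.continuous_cosh.pow 2).mul (greenJ_continuous kc)
  unfold greenG
  rw [hV]; ring

/-- A local maximum has nonpositive second derivative. -/
lemma second_deriv_nonpos_of_isLocalMax {F F' : ℝ → ℝ} {F'' x : ℝ}
    (h1 : ∀ᶠ y in nhds x, HasDerivAt F (F' y) y) (h2 : HasDerivAt F' F'' x)
    (hmax : IsLocalMax F x) : F'' ≤ 0 := by
  by_contra hpos
  push Not at hpos
  have e1 : deriv F =ᶠ[nhds x] F' := h1.mono fun y hy => hy.deriv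
  have e2 : deriv (deriv F) x = F'' := by rw [e1.deriv_eq, h2.deriv]
  have hmin : IsLocalMin F x := isLocalMin_of_deriv_deriv_pos (by rw [e2]; exact hpos)
    hmax.deriv_eq_zero h1.self_of_nhds.continuousAt
  have e3 : F =ᶠ[nhds x] fun _ => F x := by
    filter_upwards [hmax, hmin] with y hy1 hy2 using le_antisymm hy1 hy2
  have e4 : deriv F =ᶠ[nhds x] fun _ => 0 := by
    filter_upwards [e3.eventually_nhds] with y hy
    have : F =ᶠ[nhds y] fun _ => F x := hy
    rw [this.deriv_eq]; simp
  have e5 : deriv (deriv F) x = 0 := by rw [e4.deriv_eq]; simp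
  linarith

lemma inv_cosh_sq_shift (x : ℝ) :
    1 / Real.cosh x ^ 2 - 1 / Real.cosh (x + 1 / 8) ^ 2 ≤ 1 / 4 := by
  have hcp : 0 < Real.cosh (x + 1 / 8) := Real.cosh_pos _
  have hcx := Real.cosh_pos x
  have hcosh : Real.cosh (x + 1 / 8) ≤ Real.cosh x * Real.exp (1 / 8) := by
    rw [Real.cosh_add, ← Real.cosh_add_sinh (1 / 8 : ℝ), mul_add]
    have h1 : Real.sinh x ≤ Real.cosh x := (Real.sinh_lt_cosh x).le
    have h2 : 0 ≤ Real.sinh (1 / 8 : ℝ) := by rw [Real.sinh_nonneg_iff]; norm_num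
    have := mul_le_mul_of_nonneg_right h1 h2
    linarith
  have h1 : 3 / 4 * (1 / Real.cosh x ^ 2) ≤ 1 / Real.cosh (x + 1 / 8) ^ 2 := by
    have h2 : Real.cosh (x + 1 / 8) ^ 2 ≤ Real.cosh x ^ 2 * Real.exp (1 / 4) := by
      have := pow_le_pow_left₀ hcp.le hcosh 2
      rw [mul_pow, ← Real.exp_nat_mul] at this
      norm_num at this ⊢
      exact this
    have h3 : 3 / 4 * Real.exp (1 / 4) ≤ 1 := by
      have h4 := Real.add_one_le_exp (-(1 / 4) : ℝ)
      have h5 : Real.exp (-(1 / 4)) * Real.exp (1 / 4 : ℝ) = 1 := by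
        rw [← Real.exp_add]; simp
      have h6 := Real.exp_pos (1 / 4 : ℝ)
      nlinarith
    rw [mul_one_div, div_le_div_iff₀ (by positivity) (pow_pos hcp 2)]
    have h7 : 0 < Real.cosh x ^ 2 := by positivity
    have h9 := mul_le_mul_of_nonneg_left h3 h7.le
    linarith
  have h8 : 1 / Real.cosh x ^ 2 ≤ 1 := by
    rw [div_le_one (by positivity)]
    have := Real.one_le_cosh x
    nlinarith
  linarith

/-- Comparison principle on the half line. -/
lemma half_le {B μ r : ℝ} {g Q1 P1 Q2 P2 : ℝ → ℝ} (hg : ∀ s, |g s| ≤ B)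
    (hsm : r + |μ| * B ≤ 1 / 4)
    (c1 : Continuous Q1) (c2 : Continuous Q2) (h0 : Q1 0 = Q2 0)
    (b1 : ∀ s, 0 ≤ s → |Q1 s - q0 s| ≤ r) (b2 : ∀ s, 0 ≤ s → |Q2 s - q0 s| ≤ r)
    (d1 : ∀ s, 0 < s → HasDerivAt Q1 (P1 s) s) (d2 : ∀ s, 0 < s → HasDerivAt Q2 (P2 s) s)
    (dd1 : ∀ s, 0 < s → HasDerivAt P1 (Real.sin (Q1 s) * (1 - μ * g s)) s)
    (dd2 : ∀ s, 0 < s → HasDerivAt P2 (Real.sin (Q2 s) * (1 - μ * g s)) s)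
    (t1 : Tendsto Q1 atTop (nhds (2 * Real.pi))) (t2 : Tendsto Q2 atTop (nhds (2 * Real.pi)))
    (s : ℝ) (hs : 0 ≤ s) : Q1 s ≤ Q2 s := by
  by_contra hlt
  push Not at hlt
  set T : ℝ → ℝ := fun s => Real.sinh (s + 1 / 8) / Real.cosh (s + 1 / 8) with hT
  set T' : ℝ → ℝ := fun s => 1 / Real.cosh (s + 1 / 8) ^ 2 with hT'
  have hcp : ∀ x : ℝ, 0 < Real.cosh (x + 1 / 8) := fun x => Real.cosh_pos _
  have hTd : ∀ x, HasDerivAt T (T' x) x := by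
    intro x
    have a1 := ((hasDerivAt_id x).add_const (1 / 8)).sinh
    have a2 := ((hasDerivAt_id x).add_const (1 / 8)).cosh
    refine (a1.div a2 (hcp x).ne').congr_deriv ?_
    have := hcp x
    have h2 := Real.cosh_sq (x + 1 / 8)
    simp only [hT', id]
    congr 1
    linarith
  have hTdd : ∀ x, HasDerivAt T' (-2 / Real.cosh (x + 1 / 8) ^ 2 * T x) x := by
    intro x
    have a2 := (((hasDerivAt_id x).add_const (1 / 8)).cosh).pow 2
    refine ((hasDerivAt_const x (1:ℝ)).div a2 (pow_ne_zero 2 (hcp x).ne')).congr_deriv ?_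
    have := hcp x
    simp [hT]
    field_simp
  have hT0 : 0 < T 0 := div_pos (by rw [Real.sinh_pos_iff]; norm_num) (hcp 0)
  have hTge : ∀ x, 0 ≤ x → T 0 ≤ T x := by
    intro x hx
    simp only [hT]
    rw [div_le_div_iff₀ (hcp 0) (hcp x)]
    have h1 : 0 ≤ Real.sinh ((x + 1 / 8) - (0 + 1 / 8)) := by
      rw [Real.sinh_nonneg_iff]; linarith
    rw [Real.sinh_sub] at h1
    linarith
  have hTc : Continuous T := continuous_iff_continuousAt.2 fun x => (hTd x).continuousAt
  set d : ℝ → ℝ := fun x => Q1 x - Q2 x with hd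
  have hdc : Continuous d := c1.sub c2
  have hdt : Tendsto d atTop (nhds 0) := by simpa using t1.sub t2
  have hds : 0 < d s := by simp only [hd]; linarith
  have hTs : 0 < T s := hT0.trans_le (hTge s hs)
  have hv : 0 < d s / T s * T 0 := by positivity
  obtain ⟨S, hS1, hS2⟩ := ((hdt.eventually (gt_mem_nhds hv)).and (eventually_gt_atTop s)).exists
  have hS0 : 0 ≤ S := hs.trans hS2.le
  have hvc : ContinuousOn (fun x => d x / T x) (Set.Icc 0 S) :=
    hdc.continuousOn.div hTc.continuousOn fun x hx => (hT0.trans_le (hTge x hx.1)).ne'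
  obtain ⟨x, hx, hmax⟩ := isCompact_Icc.exists_isMaxOn ⟨s, hs, hS2.le⟩ hvc
  have hmax' : ∀ y, 0 ≤ y → y ≤ S → d y / T y ≤ d x / T x := fun y h1 h2 => hmax ⟨h1, h2⟩
  have hMs := hmax' s hs hS2.le
  have hMpos : 0 < d x / T x := (div_pos hds hTs).trans_le hMs
  have hx0 : 0 < x := by
    rcases hx.1.eq_or_lt with h | h
    · rw [← h] at hMpos
      simp [hd, h0] at hMpos
    · exact h
  have hxS : x < S := by
    rcases hx.2.eq_or_lt with h | h
    · rw [h] at hMs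
      have hTS := hTge S hS0
      have : d S / T S < d s / T s := by
        rw [div_lt_iff₀ (hT0.trans_le hTS)]
        exact hS1.trans_le (mul_le_mul_of_nonneg_left hTS (by positivity))
      linarith
    · exact h
  have hTx : 0 < T x := hT0.trans_le (hTge x hx.1)
  set M := d x / T x with hM
  have hdx : d x = M * T x := by rw [hM]; field_simp
  have hdpos : 0 < d x := by rw [hdx]; positivity
  have hloc : IsLocalMax (fun y => Q1 y - Q2 y - M * T y) x := by
    filter_upwards [Ioo_mem_nhds hx0 hxS] with y hy
    have h1 := hmax' y hy.1.le hy.2.le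
    rw [div_le_iff₀ (hT0.trans_le (hTge y hy.1.le))] at h1
    simp only [hd] at h1 hdx
    linarith
  have hfin := second_deriv_nonpos_of_isLocalMax
    (F := fun y => Q1 y - Q2 y - M * T y) (F' := fun y => P1 y - P2 y - M * T' y)
    (by filter_upwards [Ioi_mem_nhds hx0] with y hy
        exact ((d1 y hy).sub (d2 y hy)).sub ((hTd y).const_mul M))
    (((dd1 x hx0).sub (dd2 x hx0)).sub ((hTdd x).const_mul M)) hloc
  have hq := sin_quad_lip (q0 x) r (Q1 x - q0 x) (Q2 x - q0 x) (b1 x hx.1) (b2 x hx.1)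
  have e1 : q0 x + (Q1 x - q0 x) = Q1 x := by ring
  have e2 : q0 x + (Q2 x - q0 x) = Q2 x := by ring
  have e3 : Q1 x - q0 x - (Q2 x - q0 x) = d x := by simp only [hd]; ring
  rw [e1, e2, e3, abs_of_pos hdpos] at hq
  have hq1 := (abs_le.1 hq).1
  have hsl : |Real.sin (Q1 x) - Real.sin (Q2 x)| ≤ d x := by
    have := Real.abs_sin_sub_sin_le (Q1 x) (Q2 x)
    rwa [show Q1 x - Q2 x = d x from rfl, abs_of_pos hdpos] at this
  have hmg : |μ * g x * (Real.sin (Q1 x) - Real.sin (Q2 x))| ≤ |μ| * B * d x := by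
    rw [abs_mul, abs_mul]
    have hB : 0 ≤ B := (abs_nonneg _).trans (hg x)
    exact mul_le_mul (mul_le_mul_of_nonneg_left (hg x) (abs_nonneg _)) hsl (abs_nonneg _)
      (by positivity)
  have hmg1 := (abs_le.1 hmg).2
  rw [cos_q0] at hq1
  have hcx := Real.cosh_pos x
  have hk := inv_cosh_sq_shift x
  set u := 1 / Real.cosh x ^ 2 with hu
  set v := 1 / Real.cosh (x + 1 / 8) ^ 2 with hv'
  have e4 : 2 / Real.cosh x ^ 2 = 2 * u := by rw [hu]; ring
  have e5 : M * (-2 / Real.cosh (x + 1 / 8) ^ 2 * T x) = -2 * v * d x := by rw [hdx, hv']; ring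
  rw [e4] at hq1
  rw [e5] at hfin
  have key : 0 < (1 - 2 * u - r - |μ| * B + 2 * v) * d x := by
    apply mul_pos _ hdpos
    linarith
  have e6 : Q1 x = d x + Q2 x := by simp only [hd]; ring
  have e7 : (1 - 2 * u) * (Q1 x - q0 x) - (1 - 2 * u) * (Q2 x - q0 x) = (1 - 2 * u) * d x := by
    simp only [hd]; ring
  linarith

/-- Perturbation term of the fixed point equation. -/
noncomputable def pertN (μ : ℝ) (g : ℝ → ℝ) (s x : ℝ) : ℝ :=
  Real.sin (q0 s + x) * (1 - μ * g s) - Real.sin (q0 s) - Real.cos (q0 s) * x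

lemma pertN_lip {μ B r : ℝ} {g : ℝ → ℝ} (hg : ∀ s, |g s| ≤ B) (s x y : ℝ)
    (hx : |x| ≤ r) (hy : |y| ≤ r) :
    |pertN μ g s x - pertN μ g s y| ≤ (r + |μ| * B) * |x - y| := by
  have h1 := sin_quad_lip (q0 s) r x y hx hy
  have h2 : |μ * g s * (Real.sin (q0 s + x) - Real.sin (q0 s + y))| ≤ |μ| * B * |x - y| := by
    rw [abs_mul, abs_mul]
    have hB : 0 ≤ B := (abs_nonneg _).trans (hg s)
    have h3 := Real.abs_sin_sub_sin_le (q0 s + x) (q0 s + y)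
    rw [add_sub_add_left_eq_sub] at h3
    exact mul_le_mul (mul_le_mul_of_nonneg_left (hg s) (abs_nonneg _)) h3 (abs_nonneg _)
      (by positivity)
  have e : pertN μ g s x - pertN μ g s y =
    ((Real.sin (q0 s + x) - Real.cos (q0 s) * x) - (Real.sin (q0 s + y) - Real.cos (q0 s) * y))
    - μ * g s * (Real.sin (q0 s + x) - Real.sin (q0 s + y)) := by
    unfold pertN; ring
  rw [e, add_mul]
  exact (abs_sub _ _).trans (add_le_add h1 h2)

lemma pertN_zero {μ B : ℝ} {g : ℝ → ℝ} (hg : ∀ s, |g s| ≤ B) (s : ℝ) :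
    |pertN μ g s 0| ≤ 4 * |μ| * B * Real.exp (-s) := by
  have e : pertN μ g s 0 = -(μ * g s * Real.sin (q0 s)) := by
    unfold pertN; rw [add_zero]; ring
  have hB : 0 ≤ B := (abs_nonneg _).trans (hg s)
  rw [e, abs_neg, abs_mul, abs_mul]
  have := mul_le_mul (mul_le_mul_of_nonneg_left (hg s) (abs_nonneg μ)) (abs_sin_q0_le (s := s))
    (abs_nonneg _) (by positivity)
  linarith

lemma pertN_continuous {μ : ℝ} {g w : ℝ → ℝ} (hg : Continuous g) (hw : Continuous w) :
    Continuous fun s => pertN μ g s (w s) := by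
  have := q0_continuous
  unfold pertN
  fun_prop

lemma pertN_decay {μ B R : ℝ} {g w : ℝ → ℝ} (hg : ∀ s, |g s| ≤ B)
    (hR : 0 ≤ R) (hw : ∀ s, 0 ≤ s → |w s| ≤ R * Real.exp (-(1 / 2) * s)) (s : ℝ) (hs : 0 ≤ s) :
    |pertN μ g s (w s)| ≤ ((R + |μ| * B) * R + 4 * |μ| * B) * Real.exp (-(1 / 2) * s) := by
  have hB : 0 ≤ B := (abs_nonneg _).trans (hg s)
  have he : Real.exp (-(1 / 2) * s) ≤ 1 := by
    rw [Real.exp_le_one_iff]; linarith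
  have h1 : |w s| ≤ R := (hw s hs).trans (by nlinarith)
  have h2 := pertN_lip (μ := μ) hg s (w s) 0 h1 (by simpa using hR)
  have h3 := pertN_zero (μ := μ) hg s
  have h4 : Real.exp (-s) ≤ Real.exp (-(1 / 2) * s) := Real.exp_le_exp.2 (by linarith)
  have h5 : |pertN μ g s (w s)| ≤ |pertN μ g s (w s) - pertN μ g s 0| + |pertN μ g s 0| := by
    have := abs_add_le (pertN μ g s (w s) - pertN μ g s 0) (pertN μ g s 0)
    simpa using this
  have h6 := mul_le_mul_of_nonneg_left h4 (show 0 ≤ 4 * |μ| * B by positivity)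
  have h7 := mul_le_mul_of_nonneg_left (hw s hs) (show 0 ≤ R + |μ| * B by positivity)
  rw [sub_zero] at h2
  linarith

/-- Existence on the half line. -/
lemma half_exists {B μ : ℝ} {g : ℝ → ℝ} (hgc : Continuous g) (hg : ∀ s, |g s| ≤ B)
    (hsm : |μ| * B ≤ 1 / 2000) :
    ∃ Q P : ℝ → ℝ, Q 0 = Real.pi ∧ (∀ s, HasDerivAt Q (P s) s) ∧
      (∀ s, 0 ≤ s → HasDerivAt P (Real.sin (Q s) * (1 - μ * g s)) s) ∧
      (∀ s, 0 ≤ s → |Q s - q0 s| ≤ 64 * B * |μ| * Real.exp (-(1 / 2) * s)) := by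
  have hB : 0 ≤ B := (abs_nonneg _).trans (hg 0)
  set R := 64 * B * |μ| with hR
  have hR0 : 0 ≤ R := by positivity
  let S : Set (BoundedContinuousFunction ℝ ℝ) :=
    {w | ∀ s, 0 ≤ s → |w s| ≤ R * Real.exp (-(1 / 2) * s)}
  have hScl : IsClosed S := by
    have : S = ⋂ (s : ℝ) (_ : 0 ≤ s), {w : BoundedContinuousFunction ℝ ℝ |
        |w s| ≤ R * Real.exp (-(1 / 2) * s)} := by
      ext w; simp [S]
    rw [this]
    refine isClosed_iInter fun s => isClosed_iInter fun _ => ?_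
    exact isClosed_le (continuous_eval_const s).abs continuous_const
  have : CompleteSpace S := hScl.completeSpace_coe
  have : Nonempty S := ⟨⟨0, fun s _ => by simp; positivity⟩⟩
  set M := (R + |μ| * B) * R + 4 * |μ| * B with hM
  have hM0 : 0 ≤ M := by positivity
  have hMR : 8 * M ≤ R := by nlinarith
  have hNc : ∀ w : S, Continuous fun s => pertN μ g s (w.1 s) :=
    fun w => pertN_continuous hgc w.1.continuous
  have hNb : ∀ w : S, ∀ s, 0 ≤ s → |pertN μ g s (w.1 s)| ≤ M * Real.exp (-(1 / 2) * s) :=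
    fun w => pertN_decay hg hR0 w.2
  have hGb : ∀ w : S, ∀ s, 0 ≤ s →
      |greenG (fun s => pertN μ g s (w.1 s)) s| ≤ R * Real.exp (-(1 / 2) * s) := by
    intro w s hs
    refine (greenG_bound (hNc w) hM0 (by norm_num) le_rfl (hNb w) hs).trans ?_
    gcongr
  have hexp : ∀ s : ℝ, 0 ≤ s → Real.exp (-(1 / 2) * s) ≤ 1 := fun s hs => by
    rw [Real.exp_le_one_iff]; linarith
  have hwR : ∀ w : S, ∀ s, 0 ≤ s → |w.1 s| ≤ R := fun w s hs =>
    (w.2 s hs).trans (mul_le_of_le_one_right hR0 (hexp s hs))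
  let Tf : S → S := fun w => ⟨BoundedContinuousFunction.ofNormedAddCommGroup
      (fun s => greenG (fun s => pertN μ g s (w.1 s)) (max s 0))
      ((greenG_continuous (hNc w)).comp (continuous_id.max continuous_const)) R
      (fun s => (hGb w _ (le_max_right _ _)).trans
        (mul_le_of_le_one_right hR0 (hexp _ (le_max_right _ _)))),
    fun s hs => by
      have := hGb w s hs
      simpa [max_eq_left hs] using this⟩
  have hTf : ∀ w : S, ∀ s, (Tf w).1 s = greenG (fun s => pertN μ g s (w.1 s)) (max s 0) :=
    fun w s => rfl
  have hcontr : ContractingWith (1 / 2) Tf := by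
    refine ⟨by rw [← NNReal.coe_lt_coe]; norm_num, LipschitzWith.of_dist_le_mul fun w z => ?_⟩
    rw [Subtype.dist_eq, Subtype.dist_eq]
    set D := dist w.1 z.1 with hD
    have hD0 : 0 ≤ D := dist_nonneg
    refine (BoundedContinuousFunction.dist_le (by positivity)).2 fun s => ?_
    rw [hTf, hTf, Real.dist_eq, ← greenG_sub (hNc w) (hNc z)
      (div_cosh_integrable (hNc w) hM0 (by norm_num) (hNb w) le_rfl)
      (div_cosh_integrable (hNc z) hM0 (by norm_num) (hNb z) le_rfl)]
    have := greenG_bound ((hNc w).sub (hNc z)) (M := (R + |μ| * B) * D) (a := 0)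
      (by positivity) le_rfl (by norm_num) (fun x hx => ?_) (le_max_right s 0)
    · refine this.trans ?_
      simp
      nlinarith
    · simp only [neg_zero, zero_mul, Real.exp_zero, mul_one]
      refine (pertN_lip hg x _ _ (hwR w x hx) (hwR z x hx)).trans ?_
      have h1 : |w.1 x - z.1 x| ≤ D := by
        rw [← Real.dist_eq]; exact BoundedContinuousFunction.dist_coe_le_dist x
      exact mul_le_mul_of_nonneg_left h1 (by positivity)
  set w := ContractingWith.fixedPoint Tf hcontr with hw
  have hfix : Tf w = w := hcontr.fixedPoint_isFixedPt
  set h : ℝ → ℝ := fun s => pertN μ g s (w.1 s) with hh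
  have heq : ∀ s, 0 ≤ s → greenG h s = w.1 s := by
    intro s hs
    have := hTf w s
    rw [hfix, max_eq_left hs] at this
    exact this.symm
  refine ⟨fun s => q0 s + greenG h s, fun s => 2 / Real.cosh s + greenG' h s, ?_, ?_, ?_, ?_⟩
  · simp [greenG_zero, q0_zero]
  · intro s
    exact (q0_hasDerivAt s).add (greenG_hasDerivAt (hNc w) s)
  · intro s hs
    refine ((q0_hasDerivAt2 s).add (greenG'_hasDerivAt (hNc w) s)).congr_deriv ?_
    have e : h s = pertN μ g s (greenG h s) := by rw [heq s hs]
    rw [show pertN μ g s (w.1 s) = h s from rfl, show (fun s => pertN μ g s (w.1 s)) = h from rfl, e]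
    unfold pertN
    ring
  · intro s hs
    simpa using hGb w s hs

lemma half_tendsto {R : ℝ} {Q : ℝ → ℝ}
    (hb : ∀ s, 0 ≤ s → |Q s - q0 s| ≤ R * Real.exp (-(1 / 2) * s)) :
    Tendsto Q atTop (nhds (2 * Real.pi)) := by
  have h1 : Tendsto (fun s : ℝ => R * Real.exp (-(1 / 2) * s)) atTop (nhds 0) := by
    have h2 : Tendsto (fun s : ℝ => -(1 / 2) * s) atTop atBot :=
      tendsto_id.const_mul_atTop_of_neg (by norm_num)
    simpa using (Real.tendsto_exp_atBot.comp h2).const_mul R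
  have h3 : Tendsto (fun s => Q s - q0 s) atTop (nhds 0) := by
    refine squeeze_zero_norm' ?_ h1
    filter_upwards [eventually_ge_atTop 0] with s hs using hb s hs
  simpa using h3.add q0_tendsto

lemma isPseudoHet_le {n : ℕ} {ω : Fin n → ℝ} {f : (Fin n → ℝ) → ℝ} {B C μ θ : ℝ} {A : Fin n → ℝ}
    (hf : ∀ x, |f x| ≤ B) (hsm : C * |μ| + |μ| * B ≤ 1 / 4) {q p : ℝ → ℝ}
    (hq : IsPseudoHet n ω f μ A θ C q) (hp : IsPseudoHet n ω f μ A θ C p) (t : ℝ) :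
    (θ ≤ t → q t ≤ p t) ∧ (t ≤ θ → p t ≤ q t) := by
  obtain ⟨qc, qb, qd, qθ, qbot, qtop⟩ := hq
  obtain ⟨pc, pb, pd, pθ, pbot, ptop⟩ := hp
  have ta : Tendsto (fun s : ℝ => s + θ) atTop atTop := tendsto_atTop_add_const_right _ _ tendsto_id
  have tb : Tendsto (fun s : ℝ => θ - s) atTop atBot := by
    have := tendsto_atBot_add_const_left atTop θ (tendsto_neg_atTop_atBot (G := ℝ))
    simpa [sub_eq_add_neg] using this
  have hda : ∀ s, HasDerivAt (fun s : ℝ => s + θ) 1 s := fun s => (hasDerivAt_id s).add_const θ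
  have hdb : ∀ s, HasDerivAt (fun s : ℝ => θ - s) (-1) s := fun s => (hasDerivAt_id s).const_sub θ
  constructor
  · intro ht
    have key := half_le (B := B) (μ := μ) (r := C * |μ|)
      (g := fun s => f (fun i => ω i * (s + θ) + A i))
      (Q1 := fun s => q (s + θ)) (Q2 := fun s => p (s + θ))
      (P1 := fun s => deriv q (s + θ)) (P2 := fun s => deriv p (s + θ))
      (fun s => hf _) hsm (qc.comp (by fun_prop)) (pc.comp (by fun_prop))
      (by simp [qθ, pθ])
      (fun s _ => by simpa using qb (s + θ)) (fun s _ => by simpa using pb (s + θ))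
      (fun s hs => by
        refine ((qd (s + θ) (by linarith [hs] : θ < s + θ).ne').1.comp s (hda s)).congr_deriv ?_
        ring)
      (fun s hs => by
        refine ((pd (s + θ) (by linarith [hs] : θ < s + θ).ne').1.comp s (hda s)).congr_deriv ?_
        ring)
      (fun s hs => by
        refine ((qd (s + θ) (by linarith [hs] : θ < s + θ).ne').2.comp s (hda s)).congr_deriv ?_
        ring)
      (fun s hs => by
        refine ((pd (s + θ) (by linarith [hs] : θ < s + θ).ne').2.comp s (hda s)).congr_deriv ?_
        ring)
      (qtop.comp ta) (ptop.comp ta) (t - θ) (by linarith)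
    simpa using key
  · intro ht
    have hb : ∀ r : ℝ → ℝ, (∀ t, |r t - q0 (t - θ)| ≤ C * |μ|) → ∀ s,
        |2 * Real.pi - r (θ - s) - q0 s| ≤ C * |μ| := by
      intro r hr s
      have h := hr (θ - s)
      rw [show θ - s - θ = -s by ring, q0_neg] at h
      rw [← abs_neg]
      convert h using 2
      ring
    have key := half_le (B := B) (μ := μ) (r := C * |μ|)
      (g := fun s => f (fun i => ω i * (θ - s) + A i))
      (Q1 := fun s => 2 * Real.pi - q (θ - s)) (Q2 := fun s => 2 * Real.pi - p (θ - s))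
      (P1 := fun s => deriv q (θ - s)) (P2 := fun s => deriv p (θ - s))
      (fun s => hf _) hsm (continuous_const.sub (qc.comp (by fun_prop)))
      (continuous_const.sub (pc.comp (by fun_prop)))
      (by simp [qθ, pθ])
      (fun s _ => hb q qb s) (fun s _ => hb p pb s)
      (fun s hs => by
        refine (((qd (θ - s) (by linarith [hs] : θ - s < θ).ne).1.comp s
          (hdb s)).const_sub (2 * Real.pi)).congr_deriv ?_
        ring)
      (fun s hs => by
        refine (((pd (θ - s) (by linarith [hs] : θ - s < θ).ne).1.comp s
          (hdb s)).const_sub (2 * Real.pi)).congr_deriv ?_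
        ring)
      (fun s hs => by
        refine ((qd (θ - s) (by linarith [hs] : θ - s < θ).ne).2.comp s (hdb s)).congr_deriv ?_
        rw [Real.sin_two_pi_sub]
        ring)
      (fun s hs => by
        refine ((pd (θ - s) (by linarith [hs] : θ - s < θ).ne).2.comp s (hdb s)).congr_deriv ?_
        rw [Real.sin_two_pi_sub]
        ring)
      (by simpa using (qbot.comp tb).const_sub (2 * Real.pi))
      (by simpa using (pbot.comp tb).const_sub (2 * Real.pi)) (θ - t) (by linarith)
    simp at key
    linarith

lemma isPseudoHet_exists {n : ℕ} {ω : Fin n → ℝ} {f : (Fin n → ℝ) → ℝ} {B μ θ : ℝ}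
    {A : Fin n → ℝ} (hfc : Continuous f)
    (hf : ∀ x, |f x| ≤ B) (hsm : |μ| * B ≤ 1 / 2000) :
    ∃ q, IsPseudoHet n ω f μ A θ (64 * B) q := by
  have hB : 0 ≤ B := (abs_nonneg _).trans (hf 0)
  obtain ⟨Q, P, Q0, Qd, Pd, Qb⟩ := half_exists (B := B) (μ := μ)
    (g := fun s => f (fun i => ω i * (s + θ) + A i)) (hfc.comp (by fun_prop)) (fun s => hf _) hsm
  obtain ⟨U, V, U0, Ud, Vd, Ub⟩ := half_exists (B := B) (μ := μ)
    (g := fun s => f (fun i => ω i * (θ - s) + A i)) (hfc.comp (by fun_prop)) (fun s => hf _) hsm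
  have Qc : Continuous Q := continuous_iff_continuousAt.2 fun s => (Qd s).continuousAt
  have Uc : Continuous U := continuous_iff_continuousAt.2 fun s => (Ud s).continuousAt
  have hda : ∀ s, HasDerivAt (fun s : ℝ => s - θ) 1 s := fun s => (hasDerivAt_id s).sub_const θ
  have hdb : ∀ s, HasDerivAt (fun s : ℝ => θ - s) (-1) s := fun s => (hasDerivAt_id s).const_sub θ
  have hdec : ∀ s : ℝ, 0 ≤ s → 64 * B * |μ| * Real.exp (-(1 / 2) * s) ≤ 64 * B * |μ| := by
    intro s hs
    refine mul_le_of_le_one_right (by positivity) ?_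
    rw [Real.exp_le_one_iff]; linarith
  set q : ℝ → ℝ := fun t => if θ ≤ t then Q (t - θ) else 2 * Real.pi - U (θ - t) with hq
  have qR : ∀ t, θ ≤ t → q t = Q (t - θ) := fun t ht => by simp only [hq]; rw [if_pos ht]
  have qL : ∀ t, t < θ → q t = 2 * Real.pi - U (θ - t) := fun t ht => by
    simp only [hq]; rw [if_neg (not_le.2 ht)]
  have dR : ∀ t, θ < t → HasDerivAt q (P (t - θ)) t := by
    intro t ht
    have h1 : HasDerivAt (fun t => Q (t - θ)) (P (t - θ)) t := by
      exact ((Qd (t - θ)).comp t (hda t)).congr_deriv (mul_one _)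
    refine h1.congr_of_eventuallyEq ?_
    filter_upwards [Ioi_mem_nhds ht] with y hy using qR y (le_of_lt hy)
  have dL : ∀ t, t < θ → HasDerivAt q (V (θ - t)) t := by
    intro t ht
    have h1 : HasDerivAt (fun t => 2 * Real.pi - U (θ - t)) (V (θ - t)) t := by
      refine (((Ud (θ - t)).comp t (hdb t)).const_sub (2 * Real.pi)).congr_deriv ?_
      ring
    refine h1.congr_of_eventuallyEq ?_
    filter_upwards [Iio_mem_nhds ht] with y hy using qL y hy
  refine ⟨q, ?_, ?_, ?_, ?_, ?_, ?_⟩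
  · refine Continuous.if_le (Qc.comp (by fun_prop)) (continuous_const.sub (Uc.comp (by fun_prop)))
      continuous_const continuous_id ?_
    intro x hx
    rw [← hx]
    rw [sub_self, Q0, U0]
    ring
  · intro t
    rcases le_or_gt θ t with ht | ht
    · rw [qR t ht]
      exact (Qb _ (by linarith)).trans (hdec _ (by linarith))
    · rw [qL t ht]
      have h1 := (Ub (θ - t) (by linarith)).trans (hdec (θ - t) (by linarith))
      rw [show t - θ = -(θ - t) by ring, q0_neg, ← abs_neg]
      rw [show -(2 * Real.pi - U (θ - t) - (2 * Real.pi - q0 (θ - t))) = U (θ - t) - q0 (θ - t) by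
        ring]
      exact h1
  · intro t ht
    rcases lt_or_gt_of_ne ht with ht | ht
    · refine ⟨(dL t ht).differentiableAt.hasDerivAt, ?_⟩
      have h1 : deriv q =ᶠ[nhds t] fun t => V (θ - t) := by
        filter_upwards [Iio_mem_nhds ht] with y hy using (dL y hy).deriv
      refine HasDerivAt.congr_of_eventuallyEq ?_ h1
      refine ((Vd (θ - t) (by linarith)).comp t (hdb t)).congr_deriv ?_
      rw [qL t ht, Real.sin_two_pi_sub, sub_sub_cancel]
      ring
    · refine ⟨(dR t ht).differentiableAt.hasDerivAt, ?_⟩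
      have h1 : deriv q =ᶠ[nhds t] fun t => P (t - θ) := by
        filter_upwards [Ioi_mem_nhds ht] with y hy using (dR y hy).deriv
      refine HasDerivAt.congr_of_eventuallyEq ?_ h1
      refine ((Pd (t - θ) (by linarith)).comp t (hda t)).congr_deriv ?_
      rw [qR t (le_of_lt ht), sub_add_cancel]
      ring
  · rw [qR θ le_rfl, sub_self, Q0]
  · have tb : Tendsto (fun s : ℝ => θ - s) atBot atTop := by
      have := tendsto_atTop_add_const_left atBot θ (tendsto_neg_atBot_atTop (G := ℝ))
      simpa [sub_eq_add_neg] using this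
    have h1 := ((half_tendsto Ub).comp tb).const_sub (2 * Real.pi)
    rw [sub_self] at h1
    refine h1.congr' ?_
    filter_upwards [eventually_lt_atBot θ] with t ht using (qL t ht).symm
  · have ta : Tendsto (fun s : ℝ => s - θ) atTop atTop := by
      have := tendsto_atTop_add_const_right atTop (-θ) (tendsto_id (α := ℝ))
      simpa [sub_eq_add_neg] using this
    refine ((half_tendsto Qb).comp ta).congr' ?_
    filter_upwards [eventually_ge_atTop θ] with t ht using (qR t ht).symm

/-- Existence and uniqueness of the 1-bump pseudo-heteroclinic solutions `q^μ_{A,θ}`,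
with constants `μ₀, C` depending only on a bound `B` for `sup |f|`. -/
theorem pseudo_heteroclinic_exists_unique (B : ℝ) (hB : 0 < B) :
    ∃ μ0 > (0:ℝ), ∃ C > (0:ℝ),
      ∀ (n : ℕ) (ω : Fin n → ℝ) (f : (Fin n → ℝ) → ℝ),
        Continuous f →
        (∀ (k : Fin n → ℤ) (x : Fin n → ℝ),
          f (x + fun i => 2 * Real.pi * (k i : ℝ)) = f x) →
        (∀ x, |f x| ≤ B) →
        ∀ (μ : ℝ), |μ| < μ0 → ∀ (A : Fin n → ℝ) (θ : ℝ),
          ∃! q : ℝ → ℝ, IsPseudoHet n ω f μ A θ C q := by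
  refine ⟨1 / (2000 * B), by positivity, 64 * B, by positivity, ?_⟩
  intro n ω f hfc _ hf μ hμ A θ
  have hsm : |μ| * B ≤ 1 / 2000 := by
    rw [lt_div_iff₀ (by positivity)] at hμ
    linarith
  have hsm2 : 64 * B * |μ| + |μ| * B ≤ 1 / 4 := by linarith
  obtain ⟨q, hq⟩ := isPseudoHet_exists (ω := ω) (A := A) (θ := θ) hfc hf hsm
  refine ⟨q, hq, fun p hp => funext fun t => ?_⟩
  have h1 := isPseudoHet_le hf hsm2 hq hp t
  have h2 := isPseudoHet_le hf hsm2 hp hq t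
  rcases le_total θ t with ht | ht
  · exact le_antisymm (h2.1 ht) (h1.1 ht)
  · exact le_antisymm (h1.2 ht) (h2.2 ht)
end

section
/- (Persistence of invariant tori) Let ω ∈ ℝ^n satisfy (H1) and let f : T^n × T¹ → ℝ be smooth. Then there exist μ_0 > 0 and C > 0 such that for every |μ| < μ_0 there are smooth ℤ^n-periodic functions a^μ : ℝ^n → ℝ^n and Q^μ, P^μ : ℝ^n → ℝ with sup-norms of a^μ, Q^μ, P^μ bounded by C|μ|, such that for every I_0 ∈ ℝ^n and every A ∈ ℝ^n the curve t ↦ (φ(t), I(t), q(t), p(t)) = (ωt + A, I_0 + a^μ(ωt + A), Q^μ(ωt + A), P^μ(ωt + A)) is a solution of the equations of motion φ̇ = ω, İ = −μ ∂_φ f(φ, q), q̇ = p, ṗ = sin q − μ ∂_q f(φ, q). In particular each torus T^μ_{I_0} = {(ψ, I_0 + a^μ(ψ), Q^μ(ψ), P^μ(ψ)) : ψ ∈ T^n} is invariant and the dynamics on it is conjugated to the rotation of speed ω. -/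
open Real Filter

section FourierPart

open MeasureTheory UnitAddTorus

noncomputable section

/-- normalised measure on the circle, as in the Mathlib file on multivariate Fourier series -/
local instance circMeasureSpace : MeasureSpace UnitAddCircle := ⟨AddCircle.haarAddCircle⟩

local instance circHaar : Measure.IsAddHaarMeasure (volume : Measure UnitAddCircle) :=
  inferInstanceAs (Measure.IsAddHaarMeasure AddCircle.haarAddCircle)

local instance circProb : IsProbabilityMeasure (volume : Measure UnitAddCircle) :=
  inferInstanceAs (IsProbabilityMeasure AddCircle.haarAddCircle)

/-- `2π ℤⁿ`-periodicity -/
def TPer {n : ℕ} {E : Type*} (g : (Fin n → ℝ) → E) : Prop :=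
  ∀ (k : Fin n → ℤ) (x : Fin n → ℝ), g (x + fun i => 2 * Real.pi * (k i : ℝ)) = g x

/-- projection to the torus -/
def tpr {n : ℕ} (x : Fin n → ℝ) : UnitAddTorus (Fin n) :=
  fun i => ((x i / (2 * Real.pi) : ℝ) : UnitAddCircle)

theorem tpr_openQuot {n : ℕ} : IsOpenQuotientMap (tpr (n := n)) := by
  have h1 : IsOpenQuotientMap (fun r : ℝ => ((r / (2 * Real.pi) : ℝ) : UnitAddCircle)) := by
    have h2 : IsOpenQuotientMap (fun r : ℝ => r / (2 * Real.pi)) :=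
      (Homeomorph.mulRight₀ ((2 * Real.pi)⁻¹) (by positivity)).isOpenQuotientMap
    exact (QuotientAddGroup.isOpenQuotientMap_mk (N := AddSubgroup.zmultiples (1:ℝ))).comp h2
  exact IsOpenQuotientMap.piMap (fun _ : Fin n => h1)

theorem tpr_eq {n : ℕ} {x y : Fin n → ℝ} (h : tpr x = tpr y) :
    ∃ k : Fin n → ℤ, x = y + fun i => 2 * Real.pi * (k i : ℝ) := by
  have h1 : ∀ i, ∃ k : ℤ, x i = y i + 2 * Real.pi * (k : ℝ) := by
    intro i
    have h2 := congrFun h i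
    simp only [tpr] at h2
    rw [← sub_eq_zero, ← AddCircle.coe_sub, AddCircle.coe_eq_zero_iff] at h2
    obtain ⟨m, hm⟩ := h2
    refine ⟨m, ?_⟩
    have : (2 * Real.pi) ≠ 0 := by positivity
    simp only [zsmul_eq_mul, mul_one] at hm
    field_simp at hm
    linarith
  choose k hk using h1
  exact ⟨k, funext hk⟩

theorem tpr_add {n : ℕ} (x y : Fin n → ℝ) : tpr (x + y) = tpr x + tpr y := by
  funext i
  simp [tpr, add_div]

theorem tpr_zero {n : ℕ} : tpr (0 : Fin n → ℝ) = 0 := by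
  funext i
  simp [tpr]

/-- a section of the projection -/
def tsec {n : ℕ} : UnitAddTorus (Fin n) → (Fin n → ℝ) := Function.surjInv tpr_openQuot.surjective

theorem tpr_tsec {n : ℕ} (y : UnitAddTorus (Fin n)) : tpr (tsec y) = y :=
  Function.surjInv_eq tpr_openQuot.surjective y

theorem TPer.tsec_tpr {n : ℕ} {E : Type*} {g : (Fin n → ℝ) → E} (hg : TPer g) (x v : Fin n → ℝ) :
    g (tsec (tpr x) + v) = g (x + v) := by
  obtain ⟨k, hk⟩ := tpr_eq (tpr_tsec (tpr x))
  rw [hk, add_right_comm, hg]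

theorem TPer.tsec_eq {n : ℕ} {E : Type*} {g : (Fin n → ℝ) → E} (hg : TPer g)
    (y : UnitAddTorus (Fin n)) (v : Fin n → ℝ) :
    g (tsec (y + tpr v)) = g (tsec y + v) := by
  have := hg.tsec_tpr (tsec y + v) 0
  rw [tpr_add, tpr_tsec] at this
  simpa using this

theorem TPer.continuous_lift {n : ℕ} {E : Type*} [TopologicalSpace E] {g : (Fin n → ℝ) → E}
    (hg : TPer g) (hc : Continuous g) : Continuous (fun y => g (tsec y)) := by
  rw [tpr_openQuot.isQuotientMap.continuous_iff]
  convert hc using 1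
  funext x
  simpa using hg.tsec_tpr x 0

theorem TPer.bounded {n : ℕ} {E : Type*} [NormedAddCommGroup E] {g : (Fin n → ℝ) → E}
    (hg : TPer g) (hc : Continuous g) : ∃ M : ℝ, 0 ≤ M ∧ ∀ x, ‖g x‖ ≤ M := by
  obtain ⟨M, hM⟩ := isCompact_univ.exists_bound_of_continuousOn
    (hg.continuous_lift hc).continuousOn
  refine ⟨max M 0, le_max_right _ _, fun x => ?_⟩
  have := hM (tpr x) trivial
  have h2 := hg.tsec_tpr x 0
  simp only [add_zero] at h2
  rw [h2] at this
  exact this.trans (le_max_left _ _)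

/-- Fourier character -/
def tchar {n : ℕ} (k : Fin n → ℤ) (x : Fin n → ℝ) : ℂ :=
  Complex.exp (((∑ i, (k i : ℝ) * x i : ℝ) : ℂ) * Complex.I)

theorem mFourier_tpr {n : ℕ} (k : Fin n → ℤ) (x : Fin n → ℝ) : mFourier k (tpr x) = tchar k x := by
  simp only [mFourier, tchar, tpr, ContinuousMap.coe_mk, fourier_coe_apply]
  rw [← Complex.exp_sum]
  congr 1
  push_cast
  rw [Finset.sum_mul]
  refine Finset.sum_congr rfl fun i _ => ?_
  have : (Real.pi : ℂ) ≠ 0 := by exact_mod_cast Real.pi_ne_zero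
  field_simp

/-- Fourier coefficient -/
def tcoef {n : ℕ} (g : (Fin n → ℝ) → ℝ) (k : Fin n → ℤ) : ℂ :=
  mFourierCoeff (fun y => ((g (tsec y) : ℝ) : ℂ)) k

/-- directional derivative -/
def tdir {n : ℕ} (v : Fin n → ℝ) (g : (Fin n → ℝ) → ℝ) : (Fin n → ℝ) → ℝ :=
  fun x => fderiv ℝ g x v

theorem TPer.fderiv {n : ℕ} {E : Type*} [NormedAddCommGroup E] [NormedSpace ℝ E]
    {g : (Fin n → ℝ) → E} (hg : TPer g) : TPer (fderiv ℝ g) := by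
  intro k x
  have h := fderiv_comp_add_right (𝕜 := ℝ) (f := g) (x := x) (fun i => 2 * Real.pi * (k i : ℝ))
  rw [← h]
  congr 1
  funext y
  exact hg k y

theorem TPer.tdir {n : ℕ} {g : (Fin n → ℝ) → ℝ} (hg : TPer g) (v : Fin n → ℝ) :
    TPer (tdir v g) := fun k x => by
  simp only [_root_.tdir, hg.fderiv k x]

theorem tdir_contDiff {n : ℕ} {g : (Fin n → ℝ) → ℝ} (hg : ContDiff ℝ (⊤ : ℕ∞) g) (v : Fin n → ℝ) :
    ContDiff ℝ (⊤ : ℕ∞) (tdir v g) :=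
  (hg.fderiv_right (m := (⊤ : ℕ∞)) (by simp)).clm_apply contDiff_const

theorem tcoef_tdir {n : ℕ} {g : (Fin n → ℝ) → ℝ} (hg : ContDiff ℝ (⊤ : ℕ∞) g) (hp : TPer g)
    (v : Fin n → ℝ) (k : Fin n → ℤ) :
    tcoef (tdir v g) k = (((∑ i, (k i : ℝ) * v i : ℝ) : ℂ) * Complex.I) * tcoef g k := by
  have hdc := (tdir_contDiff hg v).continuous
  obtain ⟨M, hM0, hM⟩ := (hp.tdir v).bounded hdc
  have hder : ∀ (x : Fin n → ℝ) (s : ℝ),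
      HasDerivAt (fun s : ℝ => g (x + s • v)) (tdir v g (x + s • v)) s := by
    intro x s
    have h1 : HasFDerivAt g (_root_.fderiv ℝ g (x + s • v)) (x + s • v) :=
      (hg.differentiable (by simp)).differentiableAt.hasFDerivAt
    have h2 : HasDerivAt (fun s : ℝ => x + s • v) v s := by
      simpa using ((hasDerivAt_id s).smul_const v).const_add x
    exact h1.comp_hasDerivAt s h2
  have hcont : ∀ {h : (Fin n → ℝ) → ℝ}, Continuous h → TPer h → ∀ s : ℝ, 
      Continuous (fun y : UnitAddTorus (Fin n) => mFourier (-k) y • ((h (tsec y + s • v) : ℝ) : ℂ)) := by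
    intro h hh hph s
    have h3 := (hph.continuous_lift hh).comp (continuous_add_const (tpr (s • v)))
    have h4 : Continuous (fun y => h (tsec y + s • v)) := by
      convert h3 using 2 with y
      exact (hph.tsec_eq y _).symm
    exact (mFourier (-k)).continuous.smul (Complex.continuous_ofReal.comp h4)
  have key := hasDerivAt_integral_of_dominated_loc_of_deriv_le
    (μ := (volume : Measure (UnitAddTorus (Fin n))))
    (F := fun (s : ℝ) y => mFourier (-k) y • ((g (tsec y + s • v) : ℝ) : ℂ))
    (F' := fun (s : ℝ) y => mFourier (-k) y • ((tdir v g (tsec y + s • v) : ℝ) : ℂ))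
    (x₀ := (0:ℝ)) (s := Set.univ) (bound := fun _ => M) Filter.univ_mem
    (Eventually.of_forall fun s => (hcont hg.continuous hp s).aestronglyMeasurable)
    ((hcont hg.continuous hp 0).integrable_of_hasCompactSupport (HasCompactSupport.of_compactSpace _))
    (hcont hdc (hp.tdir v) 0).aestronglyMeasurable
    (Eventually.of_forall fun y s _ => by
      rw [norm_smul]
      have h1 : ‖mFourier (-k) y‖ ≤ 1 := by
        exact (ContinuousMap.norm_coe_le_norm _ _).trans (mFourier_norm (n := -k)).le
      have h2 : ‖((tdir v g (tsec y + s • v) : ℝ) : ℂ)‖ ≤ M := by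
        rw [Complex.norm_real]; exact hM _
      calc _ ≤ 1 * M := mul_le_mul h1 h2 (norm_nonneg _) zero_le_one
        _ = M := one_mul M)
    (integrable_const M)
    (Eventually.of_forall fun y s _ => by
      simpa only [smul_eq_mul] using ((hder (tsec y) s).ofReal_comp).const_mul (mFourier (-k) y))
  have h5 : ∀ s : ℝ, ∫ y, mFourier (-k) y • ((g (tsec y + s • v) : ℝ) : ℂ)
      = tchar k (s • v) * tcoef g k := by
    intro s
    have h6 := integral_add_right_eq_self (μ := (volume : Measure (UnitAddTorus (Fin n))))
      (fun y => mFourier (-k) (y - tpr (s • v)) • ((g (tsec y) : ℝ) : ℂ)) (tpr (s • v))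
    simp only [add_sub_cancel_right] at h6
    have h7 : ∀ y, g (tsec y + s • v) = g (tsec (y + tpr (s • v))) := fun y => (hp.tsec_eq y _).symm
    simp_rw [h7]
    rw [h6, tcoef, mFourierCoeff, ← integral_const_mul]
    congr 1
    funext y
    have h8 : mFourier (-k) (y - tpr (s • v)) = tchar k (s • v) * mFourier (-k) y := by
      have h9 : ∀ a b : UnitAddTorus (Fin n), mFourier (-k) (a - b) = mFourier (-k) a * mFourier k b := by
        intro a b
        simp only [mFourier, ContinuousMap.coe_mk, ← Finset.prod_mul_distrib]
        refine Finset.prod_congr rfl fun i _ => ?_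
        simp [fourier_apply, sub_eq_add_neg, smul_add, AddCircle.toCircle_add]
      rw [h9, mFourier_tpr, mul_comm]
    rw [h8, smul_eq_mul, smul_eq_mul, mul_assoc]
  simp_rw [h5] at key
  have h10 : HasDerivAt (fun s : ℝ => tchar k (s • v) * tcoef g k)
      ((((∑ i, (k i : ℝ) * v i : ℝ) : ℂ) * Complex.I) * tcoef g k) 0 := by
    have h11 : ∀ s : ℝ, tchar k (s • v)
        = Complex.exp ((s : ℂ) * (((∑ i, (k i : ℝ) * v i : ℝ) : ℂ) * Complex.I)) := by
      intro s
      simp only [tchar]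
      congr 1
      rw [← mul_assoc, ← Complex.ofReal_mul, Finset.mul_sum]
      simp only [Pi.smul_apply, smul_eq_mul]
      congr 3
      funext i; ring
    simp_rw [h11]
    apply HasDerivAt.mul_const
    have h12 : HasDerivAt (fun s : ℝ => (s : ℂ) * (((∑ i, (k i : ℝ) * v i : ℝ) : ℂ) * Complex.I))
        (1 * (((∑ i, (k i : ℝ) * v i : ℝ) : ℂ) * Complex.I)) 0 :=
      (Complex.ofRealCLM.hasDerivAt (x := 0)).mul_const _
    simpa using h12.cexp
  have := key.2.unique h10
  rw [← this]
  simp [tcoef, mFourierCoeff]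

theorem tcoef_norm_le {n : ℕ} {g : (Fin n → ℝ) → ℝ} {M : ℝ} (hM : ∀ x, |g x| ≤ M) (k : Fin n → ℤ) :
    ‖tcoef g k‖ ≤ M := by
  have := norm_integral_le_of_norm_le_const (μ := (volume : Measure (UnitAddTorus (Fin n))))
    (f := fun y => mFourier (-k) y • ((g (tsec y) : ℝ) : ℂ)) (C := M)
    (Eventually.of_forall fun y => by
      rw [norm_smul]
      have h1 : ‖mFourier (-k) y‖ ≤ 1 := by
        exact (ContinuousMap.norm_coe_le_norm _ _).trans (mFourier_norm (n := -k)).le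
      have h2 : ‖((g (tsec y) : ℝ) : ℂ)‖ ≤ M := by
        rw [Complex.norm_real]; exact hM _
      calc _ ≤ 1 * M := mul_le_mul h1 h2 (norm_nonneg _) zero_le_one
        _ = M := one_mul M)
  simpa [tcoef, mFourierCoeff] using this

theorem tcoef_hasSum {n : ℕ} {g : (Fin n → ℝ) → ℝ} (hc : Continuous g) (hp : TPer g)
    (hs : Summable (tcoef g)) (x : Fin n → ℝ) :
    HasSum (fun k => tcoef g k * tchar k x) ((g x : ℝ) : ℂ) := by
  have h := hasSum_mFourier_series_apply_of_summable
    (f := ⟨fun y => ((g (tsec y) : ℝ) : ℂ),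
      Complex.continuous_ofReal.comp (hp.continuous_lift hc)⟩) hs (tpr x)
  have h2 := hp.tsec_tpr x 0
  simp only [add_zero] at h2
  simpa [mFourier_tpr, h2, tcoef] using h

theorem tcoef_integrable {n : ℕ} {g : (Fin n → ℝ) → ℝ} (hc : Continuous g) (hp : TPer g)
    (k : Fin n → ℤ) : Integrable (fun y => mFourier (-k) y • ((g (tsec y) : ℝ) : ℂ)) volume :=
  ((mFourier (-k)).continuous.smul
    (Complex.continuous_ofReal.comp (hp.continuous_lift hc))).integrable_of_hasCompactSupport
    (HasCompactSupport.of_compactSpace _)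

theorem tcoef_add {n : ℕ} {g h : (Fin n → ℝ) → ℝ} (hc : Continuous g) (hp : TPer g)
    (hc' : Continuous h) (hp' : TPer h) (k : Fin n → ℤ) :
    tcoef (fun x => g x + h x) k = tcoef g k + tcoef h k := by
  simp only [tcoef, mFourierCoeff]
  rw [← integral_add (tcoef_integrable hc hp k) (tcoef_integrable hc' hp' k)]
  congr 1
  funext y
  push_cast
  rw [smul_add]

theorem tcoef_const_mul {n : ℕ} (c : ℝ) (g : (Fin n → ℝ) → ℝ) (k : Fin n → ℤ) :
    tcoef (fun x => c * g x) k = (c : ℂ) * tcoef g k := by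
  simp only [tcoef, mFourierCoeff]
  rw [← integral_const_mul]
  congr 1
  funext y
  push_cast
  simp only [smul_eq_mul]
  ring

end

end FourierPart

section CohomPart

/-- sup norm of an integer vector -/
noncomputable def knorm {n : ℕ} (k : Fin n → ℤ) : ℝ := ‖(fun i => (k i : ℝ))‖

theorem knorm_nonneg {n : ℕ} (k : Fin n → ℤ) : 0 ≤ knorm k := norm_nonneg _

theorem knorm_attained {n : ℕ} {k : Fin n → ℤ} (hk : k ≠ 0) : ∃ j, |(k j : ℝ)| = knorm k := by
  have : Nonempty (Fin n) := by
    by_contra h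
    rw [not_nonempty_iff] at h
    exact hk (Subsingleton.elim _ _)
  obtain ⟨j, -, hj⟩ := Finset.exists_max_image Finset.univ (fun j => |(k j : ℝ)|)
    Finset.univ_nonempty
  refine ⟨j, le_antisymm (norm_le_pi_norm (fun i => (k i : ℝ)) j) ?_⟩
  exact (pi_norm_le_iff_of_nonneg (abs_nonneg _)).2 fun i => hj i (Finset.mem_univ i)

theorem one_le_knorm {n : ℕ} {k : Fin n → ℤ} (hk : k ≠ 0) : 1 ≤ knorm k := by
  obtain ⟨i, hi⟩ : ∃ i, k i ≠ 0 := by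
    by_contra! h
    exact hk (funext h)
  have h1 : (1:ℝ) ≤ |(k i : ℝ)| := by exact_mod_cast Int.one_le_abs hi
  exact h1.trans (norm_le_pi_norm (fun i => (k i : ℝ)) i)

theorem summable_knorm (n : ℕ) : Summable (fun k : Fin n → ℤ => (knorm k)⁻¹ ^ (n + 1)) := by
  let b := Pi.basisFun ℝ (Fin n)
  let L : Submodule ℤ (Fin n → ℝ) := Submodule.span ℤ (Set.range b)
  have hr : Module.finrank ℤ L = n := by
    rw [Module.finrank_eq_card_basis (b.restrictScalars ℤ)]
    simp
  have hs := ZLattice.summable_norm_pow_inv L (n + 1) (by omega)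
  have hmem : ∀ k : Fin n → ℤ, (fun i => (k i : ℝ)) ∈ L := by
    intro k
    have : (fun i => (k i : ℝ)) = ∑ i, k i • b i := by
      funext j
      simp [b, Finset.sum_apply, Pi.single_apply]
    rw [this]
    exact Submodule.sum_mem _ fun i _ =>
      Submodule.smul_mem _ _ (Submodule.subset_span (Set.mem_range_self i))
  have hinj : Function.Injective (fun k : Fin n → ℤ => (⟨fun i => (k i : ℝ), hmem k⟩ : L)) := by
    intro k l h
    have h1 : (fun i => (k i : ℝ)) = (fun i => (l i : ℝ)) := congrArg Subtype.val h
    funext i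
    have h2 : (k i : ℝ) = (l i : ℝ) := congrFun h1 i
    exact_mod_cast h2
  have h3 := hs.comp_injective hinj
  have h4 : (fun k : Fin n → ℤ => (knorm k)⁻¹ ^ (n + 1)) = (fun z : L => ‖z‖⁻¹ ^ (n + 1)) ∘
      (fun k : Fin n → ℤ => (⟨fun i => (k i : ℝ), hmem k⟩ : L)) := by
    funext k
    simp only [Function.comp_apply, knorm, Submodule.coe_norm]
  rw [h4]
  exact h3

theorem tdir_iter {n : ℕ} {g : (Fin n → ℝ) → ℝ} (hg : ContDiff ℝ (⊤ : ℕ∞) g) (hp : TPer g)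
    (v : Fin n → ℝ) (m : ℕ) :
    ContDiff ℝ (⊤ : ℕ∞) ((tdir v)^[m] g) ∧ TPer ((tdir v)^[m] g) ∧
    ∀ k, tcoef ((tdir v)^[m] g) k
      = (((∑ i, (k i : ℝ) * v i : ℝ) : ℂ) * Complex.I) ^ m * tcoef g k := by
  induction m with
  | zero => simpa using ⟨hg, hp⟩
  | succ m ih =>
    obtain ⟨h1, h2, h3⟩ := ih
    rw [Function.iterate_succ_apply']
    refine ⟨tdir_contDiff h1 v, h2.tdir v, fun k => ?_⟩
    rw [tcoef_tdir h1 h2, h3, pow_succ']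
    ring

theorem tcoef_decay {n : ℕ} {g : (Fin n → ℝ) → ℝ} (hg : ContDiff ℝ (⊤ : ℕ∞) g) (hp : TPer g)
    (m : ℕ) {M : ℝ} (hM : ∀ j x, |(tdir (Pi.single j 1))^[m] g x| ≤ M) {k : Fin n → ℤ}
    (hk : k ≠ 0) : knorm k ^ m * ‖tcoef g k‖ ≤ M := by
  obtain ⟨j, hj⟩ := knorm_attained hk
  have h1 := tcoef_norm_le (hM j) k
  rw [(tdir_iter hg hp _ m).2.2 k] at h1
  have h2 : (∑ i, (k i : ℝ) * (Pi.single j (1:ℝ) : Fin n → ℝ) i : ℝ) = k j := by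
    simp [Pi.single_apply]
  rw [h2] at h1
  rw [norm_mul, norm_pow, norm_mul, Complex.norm_I, mul_one, Complex.norm_real, Real.norm_eq_abs,
    hj] at h1
  exact h1

/-- linear form associated with `k` -/
noncomputable def kform {n : ℕ} (k : Fin n → ℤ) : (Fin n → ℝ) →L[ℝ] ℝ :=
  ∑ i, (k i : ℝ) • ContinuousLinearMap.proj (R := ℝ) (φ := fun _ : Fin n => ℝ) i

theorem kform_apply {n : ℕ} (k : Fin n → ℤ) (x : Fin n → ℝ) :
    kform k x = ∑ i, (k i : ℝ) * x i := by
  simp [kform]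

theorem kform_norm {n : ℕ} (k : Fin n → ℤ) : ‖kform k‖ ≤ n * knorm k := by
  refine ContinuousLinearMap.opNorm_le_bound _ (by have := knorm_nonneg k; positivity) fun x => ?_
  rw [kform_apply]
  refine (norm_sum_le _ _).trans ?_
  have : ∀ i ∈ Finset.univ, ‖(k i : ℝ) * x i‖ ≤ knorm k * ‖x‖ := fun i _ => by
    rw [norm_mul]
    exact mul_le_mul (norm_le_pi_norm (fun i => (k i : ℝ)) i) (norm_le_pi_norm x i)
      (norm_nonneg _) (knorm_nonneg k)
  refine (Finset.sum_le_sum this).trans (le_of_eq ?_)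
  simp
  ring

theorem iteratedDeriv_cis (d : ℂ) (j : ℕ) :
    iteratedDeriv j (fun s : ℝ => d * Complex.exp ((s:ℂ) * Complex.I))
      = fun s : ℝ => d * Complex.I ^ j * Complex.exp ((s:ℂ) * Complex.I) := by
  induction j with
  | zero => simp
  | succ j ih =>
    rw [iteratedDeriv_succ, ih]
    funext s
    have h12 : HasDerivAt (fun s : ℝ => (s : ℂ) * Complex.I) (1 * Complex.I) s :=
      (Complex.ofRealCLM.hasDerivAt (x := s)).mul_const _
    rw [((h12.cexp).const_mul (d * Complex.I ^ j)).deriv]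
    ring

theorem cis_contDiff (d : ℂ) {N : WithTop ℕ∞} :
    ContDiff ℝ N (fun s : ℝ => d * Complex.exp ((s:ℂ) * Complex.I)) :=
  contDiff_const.mul ((Complex.ofRealCLM.contDiff.mul contDiff_const).cexp)

theorem tchar_eq_comp {n : ℕ} (d : ℂ) (k : Fin n → ℤ) : (fun x => d * tchar k x)
      = (fun s : ℝ => d * Complex.exp ((s:ℂ) * Complex.I)) ∘ kform k := by
  funext x
  simp [tchar, kform_apply]

theorem tchar_norm {n : ℕ} (k : Fin n → ℤ) (x : Fin n → ℝ) : ‖tchar k x‖ = 1 := by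
  simp only [tchar]
  exact Complex.norm_exp_ofReal_mul_I _

theorem tchar_iter_bound {n : ℕ} (d : ℂ) (k : Fin n → ℤ) (j : ℕ) (x : Fin n → ℝ) :
    ‖iteratedFDeriv ℝ j (fun x => d * tchar k x) x‖ ≤ (n:ℝ) ^ j * (knorm k ^ j * ‖d‖) := by
  rw [tchar_eq_comp, ContinuousLinearMap.iteratedFDeriv_comp_right (n := (j : WithTop ℕ∞))
    _ (cis_contDiff d) x le_rfl]
  refine (ContinuousMultilinearMap.norm_compContinuousLinearMap_le _ _).trans ?_
  rw [norm_iteratedFDeriv_eq_norm_iteratedDeriv, iteratedDeriv_cis]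
  simp only [norm_mul, norm_pow, Complex.norm_I, one_pow, mul_one, Complex.norm_exp_ofReal_mul_I,
    Finset.prod_const, Finset.card_univ, Fintype.card_fin]
  have := pow_le_pow_left₀ (norm_nonneg _) (kform_norm k) j
  rw [mul_pow] at this
  calc _ ≤ ‖d‖ * ((n:ℝ) ^ j * knorm k ^ j) := mul_le_mul_of_nonneg_left this (norm_nonneg _)
    _ = _ := by ring

theorem tchar_per {n : ℕ} (k : Fin n → ℤ) : TPer (tchar k) := by
  intro l x
  rw [← mFourier_tpr, ← mFourier_tpr]
  congr 1
  rw [tpr_add]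
  have : tpr (fun i => 2 * Real.pi * (l i : ℝ)) = 0 := by
    funext i
    simp only [tpr, Pi.zero_apply]
    rw [AddCircle.coe_eq_zero_iff]
    refine ⟨l i, ?_⟩
    have := Real.pi_ne_zero
    simp only [zsmul_eq_mul, mul_one]
    field_simp
  rw [this, add_zero]

theorem tchar_hasDerivAt {n : ℕ} (d : ℂ) (k : Fin n → ℤ) (A ω : Fin n → ℝ) (t : ℝ) :
    HasDerivAt (fun t : ℝ => d * tchar k (A + t • ω))
      (d * ((∑ i, (k i : ℝ) * ω i : ℝ) * Complex.I) * tchar k (A + t • ω)) t := by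
  have h1 : ∀ t : ℝ, kform k (A + t • ω) = kform k A + t * kform k ω := by
    intro t; simp
  have h2 : ∀ t : ℝ, tchar k (A + t • ω)
      = Complex.exp (((kform k A + t * kform k ω : ℝ) : ℂ) * Complex.I) := by
    intro t; rw [← h1, tchar, kform_apply]
  simp_rw [h2]
  rw [← kform_apply]
  have h3 : HasDerivAt (fun t : ℝ => kform k A + t * kform k ω) (1 * kform k ω) t :=
    ((hasDerivAt_id t).mul_const (kform k ω)).const_add _
  have h4 := ((h3.ofReal_comp.mul_const Complex.I).cexp).const_mul d
  refine h4.congr_deriv ?_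
  push_cast
  ring

theorem cohom (n : ℕ) (ω : Fin n → ℝ) (γ τ : ℝ) (hγ : 0 < γ)
    (hH1 : ∀ k : Fin n → ℤ, k ≠ 0 →
      γ / ‖(fun i => (k i : ℝ))‖ ^ τ ≤ |∑ i, (k i : ℝ) * ω i|) :
    ∃ (m : ℕ) (K : ℝ), 0 < K ∧ ∀ g : (Fin n → ℝ) → ℝ, ContDiff ℝ (⊤ : ℕ∞) g → TPer g →
      tcoef g 0 = 0 → ∀ M : ℝ, 0 ≤ M → (∀ j x, |(tdir (Pi.single j 1))^[m] g x| ≤ M) →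
      ∃ a : (Fin n → ℝ) → ℝ, ContDiff ℝ (⊤ : ℕ∞) a ∧ TPer a ∧ (∀ x, |a x| ≤ K * M) ∧
        ∀ A t, HasDerivAt (fun t : ℝ => a (A + t • ω)) (g (A + t • ω)) t := by
  obtain ⟨N, hN⟩ := exists_nat_ge τ
  have hs := summable_knorm n
  set S := ∑' k : Fin n → ℤ, (knorm k)⁻¹ ^ (n + 1) with hS
  have hS0 : 0 ≤ S := tsum_nonneg fun k => pow_nonneg (inv_nonneg.2 (knorm_nonneg k)) _
  refine ⟨N + n + 1, γ⁻¹ * S + 1, by positivity, ?_⟩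
  intro g hg hp h0 M hM0 hM
  -- small divisors
  have hdiv : ∀ k : Fin n → ℤ, k ≠ 0 → |∑ i, (k i : ℝ) * ω i|⁻¹ ≤ γ⁻¹ * knorm k ^ N := by
    intro k hk
    have h1 := one_le_knorm hk
    have h2 : knorm k ^ τ ≤ knorm k ^ N := by
      rw [← Real.rpow_natCast]
      exact Real.rpow_le_rpow_of_exponent_le h1 hN
    have h3 := hH1 k hk
    change γ / knorm k ^ τ ≤ _ at h3
    have h4 : 0 < knorm k ^ τ := Real.rpow_pos_of_pos (by linarith) _
    have h5 : |∑ i, (k i : ℝ) * ω i|⁻¹ ≤ (γ / knorm k ^ τ)⁻¹ :=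
      inv_anti₀ (by positivity) h3
    refine h5.trans ?_
    rw [inv_div, div_eq_inv_mul]
    exact mul_le_mul_of_nonneg_left h2 (by positivity)
  set d : (Fin n → ℤ) → ℂ := fun k => tcoef g k / ((∑ i, (k i : ℝ) * ω i : ℝ) * Complex.I) with hd
  have hdec : ∀ (j : ℕ) (M : ℝ), 0 ≤ M →
      (∀ i x, |(tdir (Pi.single i 1))^[N + n + 1 + j] g x| ≤ M) →
      ∀ k, knorm k ^ j * ‖d k‖ ≤ (γ⁻¹ * M) * (knorm k)⁻¹ ^ (n + 1) := by
    intro j M hM0 hM k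
    by_cases hk : k = 0
    · have : d k = 0 := by simp [hd, hk, h0]
      rw [this, norm_zero, mul_zero]
      have := knorm_nonneg k
      positivity
    · have h1 := tcoef_decay hg hp _ hM hk
      have h2 := hdiv k hk
      have h3 := one_le_knorm hk
      have h4 : ‖d k‖ = ‖tcoef g k‖ * |∑ i, (k i : ℝ) * ω i|⁻¹ := by
        simp only [hd]
        rw [norm_div, norm_mul, Complex.norm_I, mul_one, Complex.norm_real, Real.norm_eq_abs,
          div_eq_mul_inv]
      have hkp : 0 < knorm k := by linarith
      rw [h4, inv_pow, ← div_eq_mul_inv (γ⁻¹ * M), le_div_iff₀ (by positivity)]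
      calc knorm k ^ j * (‖tcoef g k‖ * |∑ i, (k i : ℝ) * ω i|⁻¹) * knorm k ^ (n + 1)
          ≤ knorm k ^ j * (‖tcoef g k‖ * (γ⁻¹ * knorm k ^ N)) * knorm k ^ (n + 1) := by gcongr
        _ = γ⁻¹ * (knorm k ^ (N + n + 1 + j) * ‖tcoef g k‖) := by ring
        _ ≤ γ⁻¹ * M := by gcongr
  have hb : ∀ m : ℕ, ∃ M : ℝ, 0 ≤ M ∧ ∀ i x, |(tdir (Pi.single i 1))^[m] g x| ≤ M := by
    intro m
    have h1 : ∀ i : Fin n, ∃ M : ℝ, 0 ≤ M ∧ ∀ x, |(tdir (Pi.single i 1))^[m] g x| ≤ M := fun i => by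
      obtain ⟨h1, h2, -⟩ := tdir_iter hg hp (Pi.single i 1) m
      exact h2.bounded h1.continuous
    choose B hB0 hB using h1
    refine ⟨∑ i, B i, Finset.sum_nonneg fun i _ => hB0 i, fun i x => (hB i x).trans ?_⟩
    exact Finset.single_le_sum (f := B) (fun i _ => hB0 i) (Finset.mem_univ i)
  have hsum : ∀ j : ℕ, Summable (fun k => knorm k ^ j * ‖d k‖) := by
    intro j
    obtain ⟨M, hM0, hM⟩ := hb (N + n + 1 + j)
    refine Summable.of_nonneg_of_le (fun k => ?_) (hdec j M hM0 hM) (hs.mul_left _)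
    have := knorm_nonneg k
    positivity
  have hsd : Summable (fun k => ‖d k‖) := by simpa using hsum 0
  have hcoef : Summable (fun k => ‖tcoef g k‖) := by
    obtain ⟨M, hM0, hM⟩ := hb (n + 1)
    refine Summable.of_nonneg_of_le (fun k => norm_nonneg _) (fun k => ?_) (hs.mul_left M)
    by_cases hk : k = 0
    · rw [hk, h0, norm_zero]
      have := knorm_nonneg (0 : Fin n → ℤ)
      positivity
    · have h1 := tcoef_decay hg hp _ hM hk
      have hkp : 0 < knorm k := by have := one_le_knorm hk; linarith
      rw [inv_pow, ← div_eq_mul_inv, le_div_iff₀ (by positivity)]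
      linarith
  have hcd : ContDiff ℝ (⊤ : ℕ∞) (fun x => ∑' k, d k * tchar k x) :=
    contDiff_tsum (v := fun j k => (n:ℝ) ^ j * (knorm k ^ j * ‖d k‖))
      (fun k => by rw [tchar_eq_comp]; exact (cis_contDiff _).comp (kform k).contDiff)
      (fun j _ => (hsum j).mul_left _) (fun j k x _ => tchar_iter_bound _ _ _ _)
  refine ⟨fun x => (∑' k, d k * tchar k x).re, Complex.reCLM.contDiff.comp hcd, ?_, ?_, ?_⟩
  · intro l x
    simp only [tchar_per _ l x]
  · intro x
    refine (Complex.abs_re_le_norm _).trans ?_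
    have h1 : ∀ k, ‖d k * tchar k x‖ ≤ (γ⁻¹ * M) * (knorm k)⁻¹ ^ (n + 1) := fun k => by
      rw [norm_mul, tchar_norm, mul_one]
      simpa using hdec 0 M hM0 hM k
    have h2 := tsum_of_norm_bounded (hs.hasSum.mul_left (γ⁻¹ * M)) h1
    refine h2.trans ?_
    rw [← hS]
    nlinarith
  · intro A t
    have h1 := hasDerivAt_tsum (u := fun k => ‖tcoef g k‖)
      (g := fun k (t:ℝ) => d k * tchar k (A + t • ω))
      (g' := fun k (t:ℝ) => tcoef g k * tchar k (A + t • ω)) (y₀ := 0) hcoef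
      (fun k t => by
        refine (tchar_hasDerivAt (d k) k A ω t).congr_deriv ?_
        congr 1
        by_cases hk : k = 0
        · simp [hd, hk, h0]
        · have h2 := hH1 k hk
          have h3 := one_le_knorm hk
          change γ / knorm k ^ τ ≤ _ at h2
          have h4 : 0 < knorm k ^ τ := Real.rpow_pos_of_pos (by linarith) _
          have h5 : 0 < |∑ i, (k i : ℝ) * ω i| := lt_of_lt_of_le (by positivity) h2
          have h6 : ((∑ i, (k i : ℝ) * ω i : ℝ) : ℂ) ≠ 0 := by
            exact_mod_cast abs_pos.1 h5
          simp only [hd]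
          rw [div_mul_cancel₀]
          exact mul_ne_zero h6 Complex.I_ne_zero)
      (fun k t => by rw [norm_mul, tchar_norm, mul_one])
      (Summable.of_norm (by simpa [tchar_norm] using hsd)) t
    rw [(tcoef_hasSum hg.continuous hp hcoef.of_norm (A + t • ω)).tsum_eq] at h1
    exact (Complex.reCLM.hasFDerivAt.comp_hasDerivAt t h1)

end CohomPart

section NemPart

open BoundedContinuousFunction Topology

/-- periodicity in all variables -/
def VPer {n : ℕ} {W : Type} (g : (Fin n → ℝ) × ℝ → W) : Prop :=
  ∀ (k : Fin n → ℤ) (m : ℤ) (x : Fin n → ℝ) (y : ℝ),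
      g (x + fun i => 2 * Real.pi * (k i : ℝ), y + 2 * Real.pi * (m : ℝ)) = g (x, y)

theorem VPer.bounded {n : ℕ} {W : Type} [NormedAddCommGroup W] {g : (Fin n → ℝ) × ℝ → W}
    (hg : VPer g) (hc : Continuous g) : ∃ M : ℝ, 0 ≤ M ∧ ∀ x, ‖g x‖ ≤ M := by
  have h1 : TPer (fun z : Fin (n+1) → ℝ => g (fun i => z i.succ, z 0)) := by
    intro k z
    exact hg (fun i => k i.succ) (k 0) (fun i => z i.succ) (z 0)
  obtain ⟨M, hM0, hM⟩ := h1.bounded (by fun_prop)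
  refine ⟨M, hM0, fun x => ?_⟩
  simpa using hM (Fin.cons x.2 x.1)

/-- smooth and periodic -/
structure VNice {n : ℕ} {W : Type} [NormedAddCommGroup W] [NormedSpace ℝ W]
    (g : (Fin n → ℝ) × ℝ → W) : Prop where
  smooth : ContDiff ℝ (⊤ : ℕ∞) g
  per : VPer g

theorem VNice.fderiv {n : ℕ} {W : Type} [NormedAddCommGroup W] [NormedSpace ℝ W]
    {g : (Fin n → ℝ) × ℝ → W} (hg : VNice g) : VNice (fderiv ℝ g) := by
  refine ⟨hg.smooth.fderiv_right (m := (⊤ : ℕ∞)) (by simp), ?_⟩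
  intro k m x y
  have h := fderiv_comp_add_right (𝕜 := ℝ) (f := g) (x := (x, y))
    ((fun i => 2 * Real.pi * (k i : ℝ)), 2 * Real.pi * (m : ℝ))
  rw [Prod.mk_add_mk] at h
  rw [← h]
  congr 1
  funext z
  exact hg.per k m z.1 z.2

variable {n : ℕ} {W : Type} [NormedAddCommGroup W] [NormedSpace ℝ W]
  {α : Type} [TopologicalSpace α]

/-- Nemytskii operator -/
noncomputable def nem (g : (Fin n → ℝ) × ℝ → W) (hg : VNice g) (b : C(α, (Fin n → ℝ) × ℝ))
    (y : α →ᵇ ((Fin n → ℝ) × ℝ)) : α →ᵇ W :=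
  BoundedContinuousFunction.ofNormedAddCommGroup (fun θ => g (b θ + y θ))
    (hg.smooth.continuous.comp (b.continuous.add y.continuous))
    (hg.per.bounded hg.smooth.continuous).choose
    (fun _ => (hg.per.bounded hg.smooth.continuous).choose_spec.2 _)

@[simp] theorem nem_apply (g : (Fin n → ℝ) × ℝ → W) (hg : VNice g) (b : C(α, (Fin n → ℝ) × ℝ))
    (y : α →ᵇ ((Fin n → ℝ) × ℝ)) (θ : α) : nem g hg b y θ = g (b θ + y θ) := rfl

theorem ptw_bound {V : Type} [NormedAddCommGroup V] [NormedSpace ℝ V]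
    (T : α →ᵇ (V →L[ℝ] W)) (y : α →ᵇ V) (θ : α) : ‖T θ (y θ)‖ ≤ ‖T‖ * ‖y‖ :=
  (ContinuousLinearMap.le_opNorm _ _).trans
    (mul_le_mul (T.norm_coe_le_norm θ) (y.norm_coe_le_norm θ) (norm_nonneg _) (norm_nonneg T))

/-- pointwise application as a bounded bilinear map -/
noncomputable def ptw {V : Type} [NormedAddCommGroup V] [NormedSpace ℝ V] :
    (α →ᵇ (V →L[ℝ] W)) →L[ℝ] (α →ᵇ V) →L[ℝ] (α →ᵇ W) :=
  LinearMap.mkContinuous₂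
    (LinearMap.mk₂ ℝ
      (fun (T : α →ᵇ (V →L[ℝ] W)) (y : α →ᵇ V) =>
        BoundedContinuousFunction.ofNormedAddCommGroup (fun θ => T θ (y θ))
          (T.continuous.clm_apply y.continuous) (‖T‖ * ‖y‖)
          (ptw_bound T y))
      (fun T T' y => by ext θ; simp)
      (fun c T y => by ext θ; simp)
      (fun T y y' => by ext θ; simp)
      (fun c T y => by ext θ; simp)) 1
    (fun T y => by
      rw [one_mul]
      exact BoundedContinuousFunction.norm_ofNormedAddCommGroup_le _
        (mul_nonneg (norm_nonneg T) (norm_nonneg y)) (ptw_bound T y))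

@[simp] theorem ptw_apply {V : Type} [NormedAddCommGroup V] [NormedSpace ℝ V]
    (T : α →ᵇ (V →L[ℝ] W)) (y : α →ᵇ V) (θ : α) : ptw T y θ = T θ (y θ) := rfl

theorem nem_hasFDerivAt (g : (Fin n → ℝ) × ℝ → W) (hg : VNice g) (b : C(α, (Fin n → ℝ) × ℝ))
    (y : α →ᵇ ((Fin n → ℝ) × ℝ)) :
    HasFDerivAt (nem g hg b) (ptw (nem (fderiv ℝ g) hg.fderiv b y)) y := by
  obtain ⟨M, hM0, hM⟩ := hg.fderiv.fderiv.per.bounded hg.fderiv.fderiv.smooth.continuous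
  have hd1 : Differentiable ℝ g := hg.smooth.differentiable (by simp)
  have hd2 : Differentiable ℝ (fderiv ℝ g) := hg.fderiv.smooth.differentiable (by simp)
  have hlip : ∀ z w, ‖fderiv ℝ g z - fderiv ℝ g w‖ ≤ M * ‖z - w‖ := fun z w =>
    convex_univ.norm_image_sub_le_of_norm_fderiv_le (fun x _ => hd2 x) (fun x _ => hM x)
      trivial trivial
  have htay : ∀ z h, ‖g (z + h) - g z - fderiv ℝ g z h‖ ≤ M * ‖h‖ * ‖h‖ := by
    intro z h
    have h1 := (convex_closedBall z ‖h‖).norm_image_sub_le_of_norm_fderiv_le'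
      (𝕜 := ℝ) (f := g) (φ := fderiv ℝ g z) (C := M * ‖h‖) (x := z) (y := z + h)
      (fun x _ => hd1 x) (fun x hx => (hlip x z).trans (by
        rw [mem_closedBall_iff_norm] at hx
        gcongr)) (by simp) (by simp)
    simpa using h1
  have hO : (fun h => nem g hg b (y + h) - nem g hg b y
      - ptw (nem (fderiv ℝ g) hg.fderiv b y) h) =O[𝓝 0] fun h => ‖h‖ ^ 2 := by
    refine Asymptotics.IsBigO.of_bound M (Eventually.of_forall fun h => ?_)
    rw [Real.norm_of_nonneg (by positivity)]
    refine (BoundedContinuousFunction.norm_le (by positivity)).2 fun θ => ?_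
    have h2 := htay (b θ + y θ) (h θ)
    have h3 := h.norm_coe_le_norm θ
    simp only [BoundedContinuousFunction.coe_sub, Pi.sub_apply, nem_apply, ptw_apply,
      BoundedContinuousFunction.coe_add, Pi.add_apply, ← add_assoc]
    refine h2.trans ?_
    rw [mul_assoc, pow_two]
    gcongr
  rw [hasFDerivAt_iff_isLittleO_nhds_zero]
  refine hO.trans_isLittleO ?_
  exact (Asymptotics.isLittleO_norm_pow_id one_lt_two)

theorem nem_contDiff_nat (m : ℕ) : ∀ {W : Type} [NormedAddCommGroup W] [NormedSpace ℝ W]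
    (g : (Fin n → ℝ) × ℝ → W) (hg : VNice g) (b : C(α, (Fin n → ℝ) × ℝ)),
    ContDiff ℝ m (nem g hg b) := by
  induction m with
  | zero =>
    intro W _ _ g hg b
    have h : Continuous (nem g hg b) := 
      Differentiable.continuous (𝕜 := ℝ) fun y => (nem_hasFDerivAt g hg b y).differentiableAt
    exact contDiff_zero.2 h
  | succ m ih =>
    intro W _ _ g hg b
    have h1 := ih (fderiv ℝ g) hg.fderiv b
    have h2 : fderiv ℝ (nem g hg b) = fun y => ptw (nem (fderiv ℝ g) hg.fderiv b y) :=
      funext fun y => (nem_hasFDerivAt g hg b y).fderiv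
    push_cast
    rw [contDiff_succ_iff_fderiv]
    refine ⟨fun y => (nem_hasFDerivAt g hg b y).differentiableAt, by simp, ?_⟩
    rw [h2]
    exact (ContinuousLinearMap.contDiff (𝕜 := ℝ) ptw).comp h1

theorem nem_contDiff (g : (Fin n → ℝ) × ℝ → W) (hg : VNice g) (b : C(α, (Fin n → ℝ) × ℝ)) :
    ContDiff ℝ (⊤ : ℕ∞) (nem g hg b) :=
  contDiff_infty.2 fun m => nem_contDiff_nat m g hg b

end NemPart

section ImplicitPart

open Topology

theorem smooth_implicit {E₁ E₂ : Type} [NormedAddCommGroup E₁] [NormedSpace ℝ E₁] [CompleteSpace E₁]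
    [NormedAddCommGroup E₂] [NormedSpace ℝ E₂] [CompleteSpace E₂]
    (Φ : E₁ × E₂ → E₂) (hΦ : ContDiff ℝ (⊤ : ℕ∞) Φ) (h0 : Φ 0 = 0)
    (hinv : (fderiv ℝ Φ 0 ∘L .inr ℝ E₁ E₂).IsInvertible) :
    ∃ (ψ : E₁ → E₂) (δ ε : ℝ), 0 < δ ∧ 0 < ε ∧ ψ 0 = 0 ∧
      (∀ p, ‖p‖ < δ → ContDiffAt ℝ (⊤ : ℕ∞) ψ p ∧ Φ (p, ψ p) = 0 ∧ ‖ψ p‖ < ε) ∧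
      (∀ p x, ‖p‖ < δ → ‖x‖ < ε → Φ (p, x) = 0 → x = ψ p) := by
  have pn : ((⊤ : ℕ∞) : WithTop ℕ∞) ≠ 0 := by simp
  have cdf : ContDiffAt ℝ (⊤ : ℕ∞) Φ 0 := hΦ.contDiffAt
  set ψ := cdf.implicitFunction pn hinv with hψ
  have e0 : ψ 0 = 0 := cdf.implicitFunction_apply_self pn hinv
  have e1 : ∀ᶠ p in 𝓝 (0 : E₁), Φ (p, ψ p) = 0 := by
    have := cdf.eventually_apply_implicitFunction pn hinv
    rw [h0] at this
    exact this
  have e2 : ∀ᶠ v in 𝓝 (0 : E₁ × E₂), Φ v = 0 ↔ ψ v.1 = v.2 := by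
    have := cdf.eventually_apply_eq_iff_implicitFunction pn hinv
    rw [h0] at this
    exact this
  have e3 : ContDiffAt ℝ (⊤ : ℕ∞) ψ 0 := cdf.contDiffAt_implicitFunction pn hinv
  have e4 : ∀ᶠ p in 𝓝 (0 : E₁), ContinuousAt ψ p := by
    have h1 : ContDiffAt ℝ 1 ψ 0 := e3.of_le (by exact_mod_cast le_top)
    filter_upwards [h1.eventually (by simp)] with p hp using hp.continuousAt
  have e5 : ∀ᶠ p in 𝓝 (0 : E₁), (fderiv ℝ Φ (p, ψ p) ∘L .inr ℝ E₁ E₂).IsInvertible := by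
    have hc : ContinuousAt (fun p => fderiv ℝ Φ (p, ψ p) ∘L .inr ℝ E₁ E₂) 0 := by
      have h1 : Continuous (fderiv ℝ Φ) := hΦ.continuous_fderiv (by simp)
      have h2 : ContinuousAt (fun p => (p, ψ p)) (0 : E₁) :=
        continuousAt_id.prodMk e3.continuousAt
      have h3 : ContinuousAt (fun p => fderiv ℝ Φ (p, ψ p)) (0 : E₁) :=
        ContinuousAt.comp (g := fderiv ℝ Φ) h1.continuousAt h2
      exact h3.clm_comp continuousAt_const
    have ho : IsOpen {T : E₂ →L[ℝ] E₂ | T.IsInvertible} := ContinuousLinearEquiv.isOpen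
    refine hc.eventually (ho.mem_nhds ?_)
    simp only [Set.mem_ofPred_eq, e0]
    exact hinv
  have e6 : ∀ᶠ p in 𝓝 (0 : E₁), ContDiffAt ℝ (⊤ : ℕ∞) ψ p := by
    filter_upwards [e1.eventually_nhds, e4, e5] with p h1 h4 h5
    have cdp : ContDiffAt ℝ (⊤ : ℕ∞) Φ (p, ψ p) := hΦ.contDiffAt
    have h6 := cdp.eventually_apply_eq_iff_implicitFunction pn h5
    have h7 : Tendsto (fun q => (q, ψ q)) (𝓝 p) (𝓝 (p, ψ p)) := continuousAt_id.prodMk h4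
    have h8 := h7.eventually h6
    refine (cdp.contDiffAt_implicitFunction pn h5).congr_of_eventuallyEq ?_
    filter_upwards [h8, h1] with q h9 h10
    exact (h9.1 (by rw [h10, h1.self_of_nhds])).symm
  obtain ⟨r, hr, hr2⟩ := Metric.eventually_nhds_iff.1 e2
  have e7 : ∀ᶠ p in 𝓝 (0 : E₁), ‖ψ p‖ < r := by
    have h1 : Tendsto (fun p => ‖ψ p‖) (𝓝 0) (𝓝 ‖ψ 0‖) := e3.continuousAt.norm
    rw [e0, norm_zero] at h1
    exact h1.eventually (gt_mem_nhds hr)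
  obtain ⟨s, hs, hs2⟩ := Metric.eventually_nhds_iff.1 ((e1.and e6).and e7)
  refine ⟨ψ, min s r, r, lt_min hs hr, hr, e0, ?_, ?_⟩
  · intro p hp
    have := hs2 (y := p) (by rw [dist_zero_right]; exact hp.trans_le (min_le_left _ _))
    exact ⟨this.1.2, this.1.1, this.2⟩
  · intro p x hp hx h
    have := hr2 (y := (p, x)) (by
      rw [dist_zero_right, Prod.norm_def]
      exact max_lt (hp.trans_le (min_le_right _ _)) hx)
    exact (this.1 h).symm

end ImplicitPart

section LopPart

open BoundedContinuousFunction MeasureTheory Set Topology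

variable {n : ℕ}

theorem lop_integrable (v : Fin n → ℝ) (h : (Fin n → ℝ) →ᵇ ℝ) (θ : Fin n → ℝ) (c : ℝ) :
    IntegrableOn (fun s : ℝ => Real.exp (-s) * h (θ + s • v)) (Ioi c) := by
  have h1 : IntegrableOn (fun s : ℝ => Real.exp (-s)) (Ioi c) := integrableOn_exp_neg_Ioi c
  refine Integrable.mul_bdd (c := ‖h‖) h1 ?_ ?_
  · exact (by fun_prop : Continuous fun s : ℝ => h (θ + s • v)).aestronglyMeasurable
  · exact Eventually.of_forall fun s => h.norm_coe_le_norm _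

theorem lop_continuous (v : Fin n → ℝ) (h : (Fin n → ℝ) →ᵇ ℝ) :
    Continuous (fun θ => ∫ s in Ioi (0:ℝ), Real.exp (-s) * h (θ + s • v)) := by
  refine continuous_of_dominated (bound := fun s => Real.exp (-s) * ‖h‖) ?_ ?_ ?_ ?_
  · intro θ
    exact (lop_integrable v h θ 0).aestronglyMeasurable
  · intro θ
    refine Eventually.of_forall fun s => ?_
    rw [norm_mul, Real.norm_of_nonneg (Real.exp_pos _).le]
    gcongr
    exact h.norm_coe_le_norm _
  · exact (integrableOn_exp_neg_Ioi 0).mul_const _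
  · refine Eventually.of_forall fun s => ?_
    fun_prop

theorem lop_bound (v : Fin n → ℝ) (h : (Fin n → ℝ) →ᵇ ℝ) (θ : Fin n → ℝ) :
    ‖∫ s in Ioi (0:ℝ), Real.exp (-s) * h (θ + s • v)‖ ≤ ‖h‖ := by
  have h1 := norm_integral_le_of_norm_le (μ := volume.restrict (Ioi (0:ℝ)))
    (f := fun s => Real.exp (-s) * h (θ + s • v))
    (g := fun s => Real.exp (-s) * ‖h‖) ((integrableOn_exp_neg_Ioi 0).mul_const _)
    (Eventually.of_forall fun s => by
      rw [norm_mul, Real.norm_of_nonneg (Real.exp_pos _).le]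
      gcongr
      exact h.norm_coe_le_norm _)
  rwa [integral_mul_const, integral_exp_neg_Ioi_zero, one_mul] at h1

/-- `(Lop v h) θ = ∫₀^∞ e^{-s} h(θ + s v) ds` -/
noncomputable def Lop (v : Fin n → ℝ) : ((Fin n → ℝ) →ᵇ ℝ) →L[ℝ] ((Fin n → ℝ) →ᵇ ℝ) :=
  LinearMap.mkContinuous
    { toFun := fun h => BoundedContinuousFunction.ofNormedAddCommGroup
        (fun θ => ∫ s in Ioi (0:ℝ), Real.exp (-s) * h (θ + s • v)) (lop_continuous v h) ‖h‖
        (lop_bound v h)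
      map_add' := fun h h' => by
        ext θ
        simp only [BoundedContinuousFunction.coe_ofNormedAddCommGroup,
          BoundedContinuousFunction.coe_add, Pi.add_apply, mul_add]
        exact integral_add (lop_integrable v h θ 0) (lop_integrable v h' θ 0)
      map_smul' := fun c h => by
        ext θ
        simp only [BoundedContinuousFunction.coe_ofNormedAddCommGroup,
          BoundedContinuousFunction.coe_smul, smul_eq_mul, RingHom.id_apply]
        rw [← integral_const_mul]
        congr 1
        funext s
        ring } 1
    (fun h => by
      rw [one_mul]
      exact BoundedContinuousFunction.norm_ofNormedAddCommGroup_le _ (norm_nonneg h) (lop_bound v h))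

theorem Lop_apply (v : Fin n → ℝ) (h : (Fin n → ℝ) →ᵇ ℝ) (θ : Fin n → ℝ) :
    Lop v h θ = ∫ s in Ioi (0:ℝ), Real.exp (-s) * h (θ + s • v) := rfl

theorem Lop_eq (v : Fin n → ℝ) (h : (Fin n → ℝ) →ᵇ ℝ) (A : Fin n → ℝ) (t : ℝ) :
    Lop v h (A + t • v) = Real.exp t * ∫ r in Ioi t, Real.exp (-r) * h (A + r • v) := by
  rw [Lop_apply, ← integral_const_mul]
  have h1 := (measurePreserving_add_right (volume : Measure ℝ) t).setIntegral_preimage_emb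
    (MeasurableEquiv.addRight t).measurableEmbedding
    (fun r => Real.exp t * (Real.exp (-r) * h (A + r • v))) (Ioi t)
  rw [← h1]
  have h2 : (fun x : ℝ => x + t) ⁻¹' Ioi t = Ioi 0 := by ext x; simp
  rw [h2]
  congr 1
  funext s
  rw [← mul_assoc, ← Real.exp_add]
  congr 2
  · ring
  · rw [add_smul]; abel_nf

theorem Lop_hasDerivAt (v : Fin n → ℝ) (h : (Fin n → ℝ) →ᵇ ℝ) (A : Fin n → ℝ) (t : ℝ) :
    HasDerivAt (fun t : ℝ => Lop v h (A + t • v)) (Lop v h (A + t • v) - h (A + t • v)) t := by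
  set F : ℝ → ℝ := fun r => Real.exp (-r) * h (A + r • v) with hF
  have hFc : Continuous F := by fun_prop
  have h1 : ∀ t, Lop v h (A + t • v) = Real.exp t * ((∫ r in Ioi (0:ℝ), F r) - ∫ r in (0:ℝ)..t, F r) := by
    intro t
    rw [Lop_eq, ← intervalIntegral.integral_interval_add_Ioi (a := 0) (b := t)
      (lop_integrable v h A 0) (lop_integrable v h A t)]
    ring
  have h2 : HasDerivAt (fun t => ∫ r in (0:ℝ)..t, F r) (F t) t :=
    (hFc.integral_hasStrictDerivAt 0 t).hasDerivAt
  have h3 := (Real.hasDerivAt_exp t).mul (h2.const_sub (∫ r in Ioi (0:ℝ), F r))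
  have h4 : (fun t : ℝ => Lop v h (A + t • v)) = fun t => Real.exp t * ((∫ r in Ioi (0:ℝ), F r) - ∫ r in (0:ℝ)..t, F r) :=
    funext h1
  rw [h4, h1]
  refine h3.congr_deriv ?_
  have h5 : Real.exp t * F t = h (A + t • v) := by
    simp only [hF]
    rw [← mul_assoc, ← Real.exp_add]; simp
  linear_combination -h5

theorem Lop_neg_hasDerivAt (v : Fin n → ℝ) (h : (Fin n → ℝ) →ᵇ ℝ) (A : Fin n → ℝ) (t : ℝ) :
    HasDerivAt (fun t : ℝ => Lop (-v) h (A + t • v)) (h (A + t • v) - Lop (-v) h (A + t • v)) t := by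
  have h1 := Lop_hasDerivAt (-v) h A (-t)
  have h2 := h1.scomp t (hasDerivAt_neg t)
  simp only [smul_neg, neg_smul, neg_neg, one_smul, neg_sub, Function.comp_def] at h2
  exact h2

end LopPart

section QPart

open BoundedContinuousFunction Set Topology

variable {n : ℕ}

/-- the embedding `(η, x) ↦ (θ ↦ (η, x θ))` -/
noncomputable def Jop : ((Fin n → ℝ) × ((Fin n → ℝ) →ᵇ ℝ)) →L[ℝ] ((Fin n → ℝ) →ᵇ ((Fin n → ℝ) × ℝ)) :=
  LinearMap.mkContinuous
    { toFun := fun z => BoundedContinuousFunction.ofNormedAddCommGroup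
        (fun θ => (z.1, z.2 θ)) (by fun_prop) ‖z‖
        (fun θ => by
          rw [Prod.norm_def, Prod.norm_def]
          exact max_le_max le_rfl (z.2.norm_coe_le_norm θ))
      map_add' := fun h h' => by
        ext θ <;> simp
      map_smul' := fun c h => by
        ext θ <;> simp } 1
    (fun z => by
      rw [one_mul]
      exact BoundedContinuousFunction.norm_ofNormedAddCommGroup_le _ (norm_nonneg z) (fun θ => by
          rw [Prod.norm_def, Prod.norm_def]
          exact max_le_max le_rfl (z.2.norm_coe_le_norm θ)))

theorem Jop_apply (z : (Fin n → ℝ) × ((Fin n → ℝ) →ᵇ ℝ)) (θ : Fin n → ℝ) :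
    Jop z θ = (z.1, z.2 θ) := rfl

/-- base point map `θ ↦ (θ, 0)` -/
def bmap : C(Fin n → ℝ, (Fin n → ℝ) × ℝ) := ⟨fun θ => (θ, 0), by fun_prop⟩

theorem bmap_apply (θ : Fin n → ℝ) : bmap θ = (θ, (0:ℝ)) := rfl

theorem sin_nice : VNice (fun p : (Fin n → ℝ) × ℝ => Real.sin p.2) := by
  refine ⟨Real.contDiff_sin.comp contDiff_snd, fun k m x y => ?_⟩
  simp only
  rw [mul_comm (2 * Real.pi), Real.sin_add_int_mul_two_pi]

/-- the nonlinear term -/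
noncomputable def Nop (g : (Fin n → ℝ) × ℝ → ℝ) (hg : VNice g)
    (z : ((Fin n → ℝ) × ℝ) × ((Fin n → ℝ) →ᵇ ℝ)) : (Fin n → ℝ) →ᵇ ℝ :=
  nem _ sin_nice bmap (Jop (z.1.1, z.2)) - z.2 - z.1.2 • nem g hg bmap (Jop (z.1.1, z.2))

theorem Nop_apply (g : (Fin n → ℝ) × ℝ → ℝ) (hg : VNice g) (η : Fin n → ℝ) (μ : ℝ)
    (x : (Fin n → ℝ) →ᵇ ℝ) (θ : Fin n → ℝ) :
    Nop g hg ((η, μ), x) θ = Real.sin (x θ) - x θ - μ * g (θ + η, x θ) := by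
  simp [Nop, Jop_apply, bmap_apply]

theorem Nop_contDiff (g : (Fin n → ℝ) × ℝ → ℝ) (hg : VNice g) :
    ContDiff ℝ (⊤ : ℕ∞) (Nop g hg) := by
  have hJ : ContDiff ℝ (⊤ : ℕ∞) (fun z : ((Fin n → ℝ) × ℝ) × ((Fin n → ℝ) →ᵇ ℝ) =>
      Jop (z.1.1, z.2)) :=
    (ContinuousLinearMap.contDiff (𝕜 := ℝ) Jop).comp
      ((contDiff_fst.comp contDiff_fst).prodMk contDiff_snd)
  have h1 := (nem_contDiff _ (sin_nice (n := n)) bmap).comp hJ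
  have h2 := (nem_contDiff g hg bmap).comp hJ
  exact (h1.sub contDiff_snd).sub ((contDiff_snd.comp contDiff_fst).smul h2)

/-- the functional whose zeros give the tori -/
noncomputable def Phiop (ω : Fin n → ℝ) (g : (Fin n → ℝ) × ℝ → ℝ) (hg : VNice g)
    (z : ((Fin n → ℝ) × ℝ) × ((Fin n → ℝ) →ᵇ ℝ)) : (Fin n → ℝ) →ᵇ ℝ :=
  z.2 + ((1/2 : ℝ) • (Lop ω + Lop (-ω))) (Nop g hg z)

theorem Phiop_contDiff (ω : Fin n → ℝ) (g : (Fin n → ℝ) × ℝ → ℝ) (hg : VNice g) :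
    ContDiff ℝ (⊤ : ℕ∞) (Phiop ω g hg) :=
  contDiff_snd.add ((ContinuousLinearMap.contDiff (𝕜 := ℝ) _).comp (Nop_contDiff g hg))

theorem Nop_zero (g : (Fin n → ℝ) × ℝ → ℝ) (hg : VNice g) : Nop g hg 0 = 0 := by
  ext θ
  have := Nop_apply g hg 0 0 0 θ
  refine Eq.trans this ?_
  simp

theorem Phiop_zero (ω : Fin n → ℝ) (g : (Fin n → ℝ) × ℝ → ℝ) (hg : VNice g) :
    Phiop ω g hg 0 = 0 := by
  rw [Phiop, Nop_zero]; simp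

theorem nem_sin_fderiv :
    HasFDerivAt (fun x : (Fin n → ℝ) →ᵇ ℝ =>
      nem (fun p : (Fin n → ℝ) × ℝ => Real.sin p.2) sin_nice bmap (Jop ((0 : Fin n → ℝ), x)))
      (ContinuousLinearMap.id ℝ ((Fin n → ℝ) →ᵇ ℝ)) 0 := by
  have h1 : HasFDerivAt (fun x : (Fin n → ℝ) →ᵇ ℝ => Jop ((0 : Fin n → ℝ), x))
      (Jop ∘L .inr ℝ (Fin n → ℝ) ((Fin n → ℝ) →ᵇ ℝ)) 0 :=
    (Jop ∘L .inr ℝ (Fin n → ℝ) ((Fin n → ℝ) →ᵇ ℝ)).hasFDerivAt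
  have h2 := nem_hasFDerivAt _ (sin_nice (n := n)) bmap (Jop ((0 : Fin n → ℝ), 0))
  have h3 := HasFDerivAt.comp (0 : (Fin n → ℝ) →ᵇ ℝ) h2 h1
  have e : ptw (nem (fderiv ℝ (fun p : (Fin n → ℝ) × ℝ => Real.sin p.2)) sin_nice.fderiv bmap
      (Jop ((0 : Fin n → ℝ), 0))) ∘L (Jop ∘L .inr ℝ (Fin n → ℝ) ((Fin n → ℝ) →ᵇ ℝ))
      = ContinuousLinearMap.id ℝ ((Fin n → ℝ) →ᵇ ℝ) := by
    refine ContinuousLinearMap.ext fun x => ?_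
    refine BoundedContinuousFunction.ext fun θ => ?_
    have h5 : HasFDerivAt (fun p : (Fin n → ℝ) × ℝ => Real.sin p.2)
        (Real.cos (θ, (0:ℝ)).2 • ContinuousLinearMap.snd ℝ (Fin n → ℝ) ℝ) (θ, (0:ℝ)) :=
      HasFDerivAt.sin (f := fun p : (Fin n → ℝ) × ℝ => p.2) hasFDerivAt_snd
    have h6 : bmap θ + Jop ((0 : Fin n → ℝ), (0 : (Fin n → ℝ) →ᵇ ℝ)) θ = (θ, (0:ℝ)) := by
      simp [Jop_apply, bmap_apply]
    rw [ContinuousLinearMap.comp_apply, ptw_apply, nem_apply, h6, h5.fderiv]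
    simp [Jop_apply]
  rw [e] at h3
  exact h3

theorem Nop_fderiv_zero (g : (Fin n → ℝ) × ℝ → ℝ) (hg : VNice g) :
    HasFDerivAt (fun x => Nop g hg (0, x)) (0 : ((Fin n → ℝ) →ᵇ ℝ) →L[ℝ] ((Fin n → ℝ) →ᵇ ℝ)) 0 := by
  have h3 := (nem_sin_fderiv (n := n)).sub (hasFDerivAt_id _)
  have h4 : (fun x => Nop g hg (0, x)) = fun x : (Fin n → ℝ) →ᵇ ℝ =>
      nem (fun p : (Fin n → ℝ) × ℝ => Real.sin p.2) sin_nice bmap (Jop ((0 : Fin n → ℝ), x)) - id x := by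
    funext x
    simp only [Nop, Prod.snd_zero, Prod.fst_zero, zero_smul, sub_zero, id]
  rw [h4]
  rw [sub_self] at h3
  exact h3

theorem Phiop_inv (ω : Fin n → ℝ) (g : (Fin n → ℝ) × ℝ → ℝ) (hg : VNice g) :
    (fderiv ℝ (Phiop ω g hg) 0 ∘L .inr ℝ ((Fin n → ℝ) × ℝ) ((Fin n → ℝ) →ᵇ ℝ)).IsInvertible := by
  have h1 : HasFDerivAt (Phiop ω g hg) (fderiv ℝ (Phiop ω g hg) 0) 0 :=
    ((Phiop_contDiff ω g hg).differentiable (by simp)).differentiableAt.hasFDerivAt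
  have h2 : HasFDerivAt (fun x : (Fin n → ℝ) →ᵇ ℝ => ((0 : (Fin n → ℝ) × ℝ), x))
      (.inr ℝ ((Fin n → ℝ) × ℝ) ((Fin n → ℝ) →ᵇ ℝ)) 0 :=
    (ContinuousLinearMap.inr ℝ ((Fin n → ℝ) × ℝ) ((Fin n → ℝ) →ᵇ ℝ)).hasFDerivAt
  have h3 := HasFDerivAt.comp (g := Phiop ω g hg) (0 : (Fin n → ℝ) →ᵇ ℝ) h1 h2
  have h4 := (hasFDerivAt_id (𝕜 := ℝ) (0 : (Fin n → ℝ) →ᵇ ℝ)).add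
    ((((1/2 : ℝ) • (Lop ω + Lop (-ω))).hasFDerivAt).comp (0 : (Fin n → ℝ) →ᵇ ℝ) (Nop_fderiv_zero g hg))
  have h5 := h3.unique h4
  rw [h5]
  refine ⟨ContinuousLinearEquiv.refl ℝ _, ?_⟩
  ext x
  simp

/-- translation -/
noncomputable def shf (η : Fin n → ℝ) (x : (Fin n → ℝ) →ᵇ ℝ) : (Fin n → ℝ) →ᵇ ℝ :=
  x.compContinuous ⟨fun θ => θ + η, by fun_prop⟩

theorem shf_apply (η : Fin n → ℝ) (x : (Fin n → ℝ) →ᵇ ℝ) (θ : Fin n → ℝ) :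
    shf η x θ = x (θ + η) := rfl

theorem shf_norm (η : Fin n → ℝ) (x : (Fin n → ℝ) →ᵇ ℝ) : ‖shf η x‖ ≤ ‖x‖ :=
  (BoundedContinuousFunction.norm_le (norm_nonneg x)).2 fun _ => x.norm_coe_le_norm _

theorem Lop_shf (v η : Fin n → ℝ) (x : (Fin n → ℝ) →ᵇ ℝ) : Lop v (shf η x) = shf η (Lop v x) := by
  ext θ
  simp only [shf_apply, Lop_apply, add_right_comm]

theorem Phiop_shf (ω : Fin n → ℝ) (g : (Fin n → ℝ) × ℝ → ℝ) (hg : VNice g) (η : Fin n → ℝ) (μ : ℝ)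
    (x : (Fin n → ℝ) →ᵇ ℝ) :
    Phiop ω g hg ((η, μ), shf η x) = shf η (Phiop ω g hg ((0, μ), x)) := by
  have h1 : Nop g hg ((η, μ), shf η x) = shf η (Nop g hg ((0, μ), x)) := by
    ext θ
    simp [Nop_apply, shf_apply]
  ext θ
  simp [Phiop, h1, shf_apply, Lop_shf]

theorem Phiop_per (ω : Fin n → ℝ) (g : (Fin n → ℝ) × ℝ → ℝ) (hg : VNice g) (k : Fin n → ℤ) (μ : ℝ)
    (x : (Fin n → ℝ) →ᵇ ℝ) :
    Phiop ω g hg (((fun i => 2 * Real.pi * (k i : ℝ)), μ), x) = Phiop ω g hg ((0, μ), x) := by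
  have h1 : Nop g hg (((fun i => 2 * Real.pi * (k i : ℝ)), μ), x) = Nop g hg ((0, μ), x) := by
    ext θ
    have := hg.per k 0 θ (x θ)
    simp only [Int.cast_zero, mul_zero, add_zero] at this
    simp [Nop_apply, this]
  simp [Phiop, h1]

theorem exists_Q (ω : Fin n → ℝ) (g : (Fin n → ℝ) × ℝ → ℝ) (hg : VNice g) :
    ∃ δ > (0:ℝ), ∃ Q : ℝ × (Fin n → ℝ) → ℝ, (∀ θ, Q (0, θ) = 0) ∧
      ∀ μ : ℝ, |μ| < δ →
        (∀ θ, ContDiffAt ℝ (⊤ : ℕ∞) Q (μ, θ)) ∧ TPer (fun θ => Q (μ, θ)) ∧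
        ∃ p : (Fin n → ℝ) → ℝ, ∀ (A : Fin n → ℝ) (t : ℝ),
          HasDerivAt (fun t : ℝ => Q (μ, A + t • ω)) (p (A + t • ω)) t ∧
          HasDerivAt (fun t : ℝ => p (A + t • ω))
            (Real.sin (Q (μ, A + t • ω)) - μ * g (A + t • ω, Q (μ, A + t • ω))) t := by
  obtain ⟨ψ, δ, ε, hδ, hε, hψ0, hψ, huniq⟩ := smooth_implicit (Phiop ω g hg)
    (Phiop_contDiff ω g hg) (Phiop_zero ω g hg) (Phiop_inv ω g hg)
  have hshift : ∀ (η : Fin n → ℝ) (μ : ℝ), ‖((0 : Fin n → ℝ), μ)‖ < δ → ‖(η, μ)‖ < δ →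
      shf η (ψ (0, μ)) = ψ (η, μ) := by
    intro η μ h0 h1
    refine huniq _ _ h1 ((shf_norm _ _).trans_lt (hψ _ h0).2.2) ?_
    rw [Phiop_shf, (hψ _ h0).2.1]
    rfl
  have hn0 : ∀ μ : ℝ, ‖((0 : Fin n → ℝ), μ)‖ = |μ| := fun μ => by
    simp [Prod.norm_def]
  refine ⟨δ, hδ, fun z => ψ (0, z.1) z.2, ?_, ?_⟩
  · intro θ
    have : ψ ((0 : Fin n → ℝ), (0:ℝ)) = 0 := hψ0
    simp [this]
  intro μ hμ
  have hμ' : ‖((0 : Fin n → ℝ), μ)‖ < δ := by rwa [hn0]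
  refine ⟨?_, ?_, ?_⟩
  · intro θ₁
    have h1 : ContDiffAt ℝ (⊤ : ℕ∞) (fun z : ℝ × (Fin n → ℝ) => ψ (z.2 - θ₁, z.1)) (μ, θ₁) := by
      have h2 : ContDiffAt ℝ (⊤ : ℕ∞) ψ (θ₁ - θ₁, μ) := by
        rw [sub_self]
        exact (hψ _ hμ').1
      exact ContDiffAt.comp (g := ψ) (f := fun z : ℝ × (Fin n → ℝ) => (z.2 - θ₁, z.1)) (μ, θ₁) h2
        ((contDiffAt_snd.sub contDiffAt_const).prodMk contDiffAt_fst)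
    have h3 : ContDiffAt ℝ (⊤ : ℕ∞) (fun z : ℝ × (Fin n → ℝ) => ψ (z.2 - θ₁, z.1) θ₁) (μ, θ₁) :=
      ContDiffAt.comp (g := fun x : (Fin n → ℝ) →ᵇ ℝ => x θ₁) _
        (BoundedContinuousFunction.evalCLM (β := ℝ) ℝ θ₁).contDiff.contDiffAt h1
    refine h3.congr_of_eventuallyEq ?_
    have h4 : ∀ᶠ z : ℝ × (Fin n → ℝ) in 𝓝 (μ, θ₁), ‖((0 : Fin n → ℝ), z.1)‖ < δ := by
      have : Continuous fun z : ℝ × (Fin n → ℝ) => ‖((0 : Fin n → ℝ), z.1)‖ := by fun_prop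
      exact this.continuousAt.eventually (gt_mem_nhds hμ')
    have h5 : ∀ᶠ z : ℝ × (Fin n → ℝ) in 𝓝 (μ, θ₁), ‖(z.2 - θ₁, z.1)‖ < δ := by
      have : Continuous fun z : ℝ × (Fin n → ℝ) => ‖(z.2 - θ₁, z.1)‖ := by fun_prop
      refine this.continuousAt.eventually (gt_mem_nhds ?_)
      simp only [sub_self]
      exact hμ'
    filter_upwards [h4, h5] with z h4 h5
    rw [← hshift _ _ h4 h5, shf_apply]
    simp
  · intro k θ
    have h1 : shf (fun i => 2 * Real.pi * (k i : ℝ)) (ψ (0, μ)) = ψ (0, μ) := by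
      refine huniq _ _ hμ' ((shf_norm _ _).trans_lt (hψ _ hμ').2.2) ?_
      rw [← Phiop_per ω g hg k, Phiop_shf, (hψ _ hμ').2.1]
      rfl
    have h2 := congrArg (fun x : (Fin n → ℝ) →ᵇ ℝ => x θ) h1
    exact h2
  · set x := ψ (0, μ) with hx
    set N := Nop g hg ((0, μ), x) with hN
    have hQ : ∀ θ, x θ = -(1/2) * (Lop ω N θ + Lop (-ω) N θ) := by
      intro θ
      have h1 := congrArg (fun x : (Fin n → ℝ) →ᵇ ℝ => x θ) (hψ _ hμ').2.1
      simp only [Phiop, ← hx, ← hN] at h1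
      simp at h1
      linarith
    refine ⟨fun θ => -(1/2) * (Lop ω N θ - Lop (-ω) N θ), fun A t => ?_⟩
    have d1 := Lop_hasDerivAt ω N A t
    have d2 := Lop_neg_hasDerivAt ω N A t
    constructor
    · have h2 : (fun t : ℝ => x (A + t • ω))
          = fun t => -(1/2) * (Lop ω N (A + t • ω) + Lop (-ω) N (A + t • ω)) := funext fun t => hQ _
      simp only []
      rw [h2]
      refine ((d1.add d2).const_mul (-(1/2))).congr_deriv ?_
      ring
    · refine ((d1.sub d2).const_mul (-(1/2))).congr_deriv ?_
      have h3 : N (A + t • ω) = Real.sin (x (A + t • ω)) - x (A + t • ω)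
          - μ * g (A + t • ω, x (A + t • ω)) := by
        rw [hN, Nop_apply, add_zero]
      have h4 := hQ (A + t • ω)
      linear_combination h3 - h4

end QPart

section FinalPart

open Set Topology

variable {n : ℕ}

/-- periodicity in the angles of a function of a parameter and the angles -/
def JPer {E : Type*} (G : ℝ × (Fin n → ℝ) → E) : Prop :=
  ∀ (k : Fin n → ℤ) (z : ℝ × (Fin n → ℝ)), G (z + (0, fun i => 2 * Real.pi * (k i : ℝ))) = G z

theorem JPer.slice {E : Type*} {G : ℝ × (Fin n → ℝ) → E} (hG : JPer G) (μ : ℝ) :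
    TPer (fun θ => G (μ, θ)) := by
  intro k θ
  have := hG k (μ, θ)
  simpa using this

theorem JPer.of_slice {E : Type*} {G : ℝ × (Fin n → ℝ) → E} (hG : ∀ μ, TPer (fun θ => G (μ, θ))) :
    JPer G := by
  intro k z
  have := hG z.1 k z.2
  simpa [Prod.add_def] using this

theorem JPer.fderiv {E : Type*} [NormedAddCommGroup E] [NormedSpace ℝ E]
    {G : ℝ × (Fin n → ℝ) → E} (hG : JPer G) : JPer (fderiv ℝ G) := by
  intro k x
  have h := fderiv_comp_add_right (𝕜 := ℝ) (f := G) (x := x)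
    ((0:ℝ), fun i => 2 * Real.pi * (k i : ℝ))
  rw [← h]
  congr 1
  funext y
  exact hG k y

/-- directional derivative in the joint space -/
noncomputable def jd (v : ℝ × (Fin n → ℝ)) (G : ℝ × (Fin n → ℝ) → ℝ) : ℝ × (Fin n → ℝ) → ℝ :=
  fun z => fderiv ℝ G z v

theorem JPer.jd {G : ℝ × (Fin n → ℝ) → ℝ} (hG : JPer G) (v : ℝ × (Fin n → ℝ)) :
    JPer (jd v G) := fun k x => by
  simp only [_root_.jd, hG.fderiv k x]

theorem jd_contDiff {G : ℝ × (Fin n → ℝ) → ℝ} (hG : ContDiff ℝ (⊤ : ℕ∞) G)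
    (v : ℝ × (Fin n → ℝ)) : ContDiff ℝ (⊤ : ℕ∞) (jd v G) :=
  (hG.fderiv_right (m := (⊤ : ℕ∞)) (by simp)).clm_apply contDiff_const

theorem jd_slice {G : ℝ × (Fin n → ℝ) → ℝ} (hG : ContDiff ℝ (⊤ : ℕ∞) G)
    (v : Fin n → ℝ) (μ : ℝ) :
    tdir v (fun θ => G (μ, θ)) = fun θ => jd (0, v) G (μ, θ) := by
  funext θ
  have h1 : HasFDerivAt G (fderiv ℝ G (μ, θ)) (μ, θ) :=
    (hG.differentiable (by simp)).differentiableAt.hasFDerivAt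
  have h2 : HasFDerivAt (fun θ : Fin n → ℝ => (μ, θ)) (.inr ℝ ℝ (Fin n → ℝ)) θ :=
    hasFDerivAt_prodMk_right μ θ
  have h3 := HasFDerivAt.comp (g := G) θ h1 h2
  have h4 : fderiv ℝ (fun θ => G (μ, θ)) θ = _ := h3.fderiv
  simp [tdir, jd, h4]

theorem jd_iter {G : ℝ × (Fin n → ℝ) → ℝ} (hG : ContDiff ℝ (⊤ : ℕ∞) G) (hp : JPer G)
    (v : Fin n → ℝ) (m : ℕ) :
    ContDiff ℝ (⊤ : ℕ∞) ((jd (0, v))^[m] G) ∧ JPer ((jd (0, v))^[m] G) ∧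
      ∀ μ : ℝ, (tdir v)^[m] (fun θ => G (μ, θ)) = fun θ => (jd (0, v))^[m] G (μ, θ) := by
  induction m with
  | zero => exact ⟨hG, hp, fun μ => rfl⟩
  | succ m ih =>
    simp only [Function.iterate_succ_apply']
    refine ⟨jd_contDiff ih.1 _, ih.2.1.jd _, fun μ => ?_⟩
    rw [ih.2.2 μ]
    exact jd_slice ih.1 v μ

theorem JPer.bounded {G : ℝ × (Fin n → ℝ) → ℝ} (hG : JPer G) (hc : Continuous G) :
    ∃ M : ℝ, 0 ≤ M ∧ ∀ μ θ, |μ| ≤ 1 → |G (μ, θ)| ≤ M := by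
  have h1 : VPer (fun z : (Fin n → ℝ) × ℝ => G (Real.sin z.2, z.1)) := by
    intro k m x y
    simp only
    rw [mul_comm (2 * Real.pi) (m : ℝ), Real.sin_add_int_mul_two_pi]
    exact hG.slice (Real.sin y) k x
  obtain ⟨M, hM0, hM⟩ := h1.bounded (by fun_prop)
  refine ⟨M, hM0, fun μ θ hμ => ?_⟩
  have := hM (θ, Real.arcsin μ)
  rw [abs_le] at hμ
  simpa [Real.sin_arcsin hμ.1 hμ.2] using this

theorem JPer.linear_bound {G : ℝ × (Fin n → ℝ) → ℝ} (hG : JPer G) (hs : ContDiff ℝ (⊤ : ℕ∞) G)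
    (h0 : ∀ θ, G (0, θ) = 0) :
    ∃ M : ℝ, 0 ≤ M ∧ ∀ μ θ, |μ| ≤ 1 → |G (μ, θ)| ≤ M * |μ| := by
  obtain ⟨M, hM0, hM⟩ := (hG.jd (1, 0)).bounded (jd_contDiff hs (1, 0)).continuous
  refine ⟨M, hM0, fun μ θ hμ => ?_⟩
  have h1 : ∀ s : ℝ, HasDerivAt (fun s : ℝ => G (s, θ)) (_root_.jd (1, 0) G (s, θ)) s := by
    intro s
    have h1 : HasFDerivAt G (_root_.fderiv ℝ G (s, θ)) (s, θ) :=
      (hs.differentiable (by simp)).differentiableAt.hasFDerivAt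
    have h2 : HasDerivAt (fun s : ℝ => (s, θ)) ((1:ℝ), (0 : Fin n → ℝ)) s :=
      (hasDerivAt_id s).prodMk (hasDerivAt_const s θ)
    exact HasFDerivAt.comp_hasDerivAt (l := G) s h1 h2
  have h2 := (convex_Icc (-1:ℝ) 1).norm_image_sub_le_of_norm_hasDerivWithin_le
    (f := fun s : ℝ => G (s, θ)) (C := M) (x := 0) (y := μ)
    (fun s _ => (h1 s).hasDerivWithinAt) (fun s hs => hM s θ (abs_le.2 (Set.mem_Icc.1 hs)))
    (Set.mem_Icc.2 (by norm_num)) (Set.mem_Icc.2 (abs_le.1 hμ))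
  simpa [h0] using h2

theorem tdir_hasDerivAt {g : (Fin n → ℝ) → ℝ} (hg : ContDiff ℝ (⊤ : ℕ∞) g) (v A : Fin n → ℝ) (t : ℝ) :
    HasDerivAt (fun t : ℝ => g (A + t • v)) (tdir v g (A + t • v)) t := by
  have h1 : HasFDerivAt g (fderiv ℝ g (A + t • v)) (A + t • v) :=
    (hg.differentiable (by simp)).differentiableAt.hasFDerivAt
  have h2 : HasDerivAt (fun s : ℝ => A + s • v) v t := by
    simpa using ((hasDerivAt_id t).smul_const v).const_add A
  exact h1.comp_hasDerivAt t h2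

theorem tdir_of_hasDerivAt {g : (Fin n → ℝ) → ℝ} (hg : ContDiff ℝ (⊤ : ℕ∞) g) (v x : Fin n → ℝ)
    {d : ℝ} (h : HasDerivAt (fun t : ℝ => g (x + t • v)) d 0) : tdir v g x = d := by
  have := (tdir_hasDerivAt hg v x 0).unique h
  simpa using this

theorem tdir_comm {g : (Fin n → ℝ) → ℝ} (hg : ContDiff ℝ (⊤ : ℕ∞) g) (v w x : Fin n → ℝ) :
    tdir v (tdir w g) x = tdir w (tdir v g) x := by
  have hd : ∀ u : Fin n → ℝ, HasFDerivAt (tdir u g) ((fderiv ℝ (fderiv ℝ g) x).flip u) x := by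
    intro u
    have h1 : HasFDerivAt (fderiv ℝ g) (fderiv ℝ (fderiv ℝ g) x) x :=
      ((hg.fderiv_right (m := (⊤ : ℕ∞)) (by simp)).differentiable
        (by simp)).differentiableAt.hasFDerivAt
    have h2 := h1.clm_apply (hasFDerivAt_const u x)
    refine h2.congr_fderiv ?_
    ext w
    simp
  have hsym : IsSymmSndFDerivAt ℝ g x :=
    hg.contDiffAt.isSymmSndFDerivAt (by
      simp only [minSmoothness_of_isRCLikeNormedField]
      exact WithTop.coe_le_coe.2 (le_top : (2 : ℕ∞) ≤ ⊤))
  have e : ∀ u v : Fin n → ℝ, tdir v (tdir u g) x = fderiv ℝ (fderiv ℝ g) x v u := by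
    intro u v
    have h1 : tdir v (tdir u g) x = fderiv ℝ (tdir u g) x v := rfl
    rw [h1, (hd u).fderiv]
    rfl
  rw [e, e]
  exact hsym v w

/-- smooth global version of `exists_Q` -/
theorem exists_Qs (ω : Fin n → ℝ) (g : (Fin n → ℝ) × ℝ → ℝ) (hg : VNice g) :
    ∃ δ > (0:ℝ), ∃ Q : ℝ × (Fin n → ℝ) → ℝ, ContDiff ℝ (⊤ : ℕ∞) Q ∧ JPer Q ∧
      (∀ θ, Q (0, θ) = 0) ∧
      ∀ μ : ℝ, |μ| < δ → ∀ x, tdir ω (tdir ω (fun θ => Q (μ, θ))) x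
        = Real.sin (Q (μ, x)) - μ * g (x, Q (μ, x)) := by
  obtain ⟨δ, hδ, Q, hQ0, hQ⟩ := exists_Q ω g hg
  let χ : ContDiffBump (0:ℝ) := ⟨δ/4, δ/2, by positivity, by linarith⟩
  set σ : ℝ → ℝ := fun μ => χ μ * μ with hσ
  have hσs : ContDiff ℝ (⊤ : ℕ∞) σ := χ.contDiff.mul contDiff_id
  have hσb : ∀ μ, |σ μ| < δ := by
    intro μ
    by_cases h : δ / 2 ≤ |μ|
    · have : χ μ = 0 := χ.zero_of_le_dist (by simpa [Real.dist_eq] using h)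
      simp [hσ, this, hδ]
    · push Not at h
      simp only [hσ, abs_mul, abs_of_nonneg χ.nonneg]
      have h1 : χ μ * |μ| ≤ 1 * |μ| := mul_le_mul_of_nonneg_right χ.le_one (abs_nonneg _)
      linarith
  have hσe : ∀ μ, |μ| < δ / 4 → σ μ = μ := by
    intro μ h
    have : χ μ = 1 := χ.one_of_mem_closedBall (by simpa [Real.dist_eq] using h.le)
    simp [hσ, this]
  have hsm : ContDiff ℝ (⊤ : ℕ∞) (fun z : ℝ × (Fin n → ℝ) => Q (σ z.1, z.2)) := by
    rw [contDiff_iff_contDiffAt]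
    intro z
    exact ContDiffAt.comp (g := Q) (f := fun z : ℝ × (Fin n → ℝ) => (σ z.1, z.2)) z
      ((hQ _ (hσb z.1)).1 z.2)
      ((hσs.comp contDiff_fst).prodMk contDiff_snd).contDiffAt
  refine ⟨δ/4, by positivity, fun z => Q (σ z.1, z.2), hsm, ?_, ?_, ?_⟩
  · exact JPer.of_slice fun μ => (hQ _ (hσb μ)).2.1
  · intro θ
    simp [hσ, hQ0]
  · intro μ hμ x
    obtain ⟨p, hp⟩ := (hQ _ (hσb μ)).2.2
    simp only []
    rw [hσe μ hμ] at hp ⊢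
    have hs : ContDiff ℝ (⊤ : ℕ∞) (fun θ => Q (μ, θ)) := by
      have := hsm.comp (contDiff_prodMk_right μ)
      simp only [Function.comp_def, hσe μ hμ] at this
      exact this
    have h1 : tdir ω (fun θ => Q (μ, θ)) = p := by
      funext y
      have := (hp y 0).1
      simp only [zero_smul, add_zero] at this
      exact tdir_of_hasDerivAt hs ω y this
    have h2 := (hp x 0).2
    simp only [zero_smul, add_zero] at h2
    rw [← h1] at h2
    exact tdir_of_hasDerivAt (tdir_contDiff hs ω) ω x h2

theorem mean_zero (ω e : Fin n → ℝ) (f : (Fin n → ℝ) × ℝ → ℝ) (hf : VNice f) (μ : ℝ) (hμ : μ ≠ 0)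
    (q : (Fin n → ℝ) → ℝ) (hq : ContDiff ℝ (⊤ : ℕ∞) q) (hp : TPer q)
    (hode : ∀ x, tdir ω (tdir ω q) x = Real.sin (q x) - μ * fderiv ℝ f (x, q x) (0, 1)) :
    tcoef (fun x => fderiv ℝ f (x, q x) (e, 0)) 0 = 0 := by
  set P := tdir ω q with hP
  have hPs : ContDiff ℝ (⊤ : ℕ∞) P := tdir_contDiff hq ω
  have hqe := tdir_contDiff hq e
  have hPp : TPer P := hp.tdir ω
  set H : (Fin n → ℝ) → ℝ := fun x => μ * f (x, q x) + Real.cos (q x) - P x * P x / 2 with hH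
  set R : (Fin n → ℝ) → ℝ := fun x => P x * tdir e q x with hR
  have hHs : ContDiff ℝ (⊤ : ℕ∞) H := by
    have h1 := hf.smooth.comp (contDiff_id.prodMk hq)
    exact ((contDiff_const.mul h1).add (Real.contDiff_cos.comp hq)).sub
      ((hPs.mul hPs).div_const 2)
  have hRs : ContDiff ℝ (⊤ : ℕ∞) R := hPs.mul hqe
  have hfp : ∀ (k : Fin n → ℤ) (x : Fin n → ℝ) (y : ℝ),
      f (x + fun i => 2 * Real.pi * (k i : ℝ), y) = f (x, y) := by
    intro k x y
    have := hf.per k 0 x y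
    simpa using this
  have hHp : TPer H := by
    intro k x
    simp only [hH, hp k x, hPp k x, hfp]
  have hRp : TPer R := by
    intro k x
    simp only [hR, hPp k x, hp.tdir e k x]
  have key : ∀ x, μ * fderiv ℝ f (x, q x) (e, 0) = tdir e H x + tdir ω R x := by
    intro x
    have d0 : ∀ {g : (Fin n → ℝ) → ℝ} (_ : ContDiff ℝ (⊤ : ℕ∞) g) (v : Fin n → ℝ),
        HasDerivAt (fun t : ℝ => g (x + t • v)) (tdir v g x) 0 := by
      intro g hg v
      have := tdir_hasDerivAt hg v x 0
      simpa using this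
    have dq := d0 hq e
    have dP := d0 hPs e
    have x0 : x + (0:ℝ) • e = x := by simp
    have x0' : x + (0:ℝ) • ω = x := by simp
    have dx : HasDerivAt (fun s : ℝ => x + s • e) e 0 := by
      simpa using ((hasDerivAt_id (0:ℝ)).smul_const e).const_add x
    have df : HasDerivAt (fun t : ℝ => f (x + t • e, q (x + t • e)))
        (fderiv ℝ f (x, q x) (e, tdir e q x)) 0 := by
      have h1 : HasFDerivAt f (fderiv ℝ f (x, q x)) (x + (0:ℝ) • e, q (x + (0:ℝ) • e)) := by
        rw [x0]
        exact (hf.smooth.differentiable (by simp)).differentiableAt.hasFDerivAt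
      exact HasFDerivAt.comp_hasDerivAt (l := f) 0 h1 (dx.prodMk dq)
    have dH := ((df.const_mul μ).add dq.cos).sub ((dP.mul dP).div_const 2)
    have eH : tdir e H x = _ := tdir_of_hasDerivAt hHs e x dH
    have dR := (d0 hPs ω).mul (d0 hqe ω)
    have eR : tdir ω R x = _ := tdir_of_hasDerivAt hRs ω x dR
    rw [eH, eR, hode x, x0, x0', tdir_comm hq ω e x, ← hP]
    have hsplit : fderiv ℝ f (x, q x) (e, tdir e q x)
        = fderiv ℝ f (x, q x) (e, 0) + tdir e q x * fderiv ℝ f (x, q x) (0, 1) := by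
      have : (e, tdir e q x) = (e, (0:ℝ)) + tdir e q x • ((0 : Fin n → ℝ), (1:ℝ)) := by
        simp
      rw [this, map_add, map_smul, smul_eq_mul]
    rw [hsplit]
    ring
  have h1 : tcoef (fun x => μ * fderiv ℝ f (x, q x) (e, 0)) 0 = 0 := by
    rw [funext key, tcoef_add (tdir_contDiff hHs e).continuous (hHp.tdir e)
      (tdir_contDiff hRs ω).continuous (hRp.tdir ω), tcoef_tdir hHs hHp, tcoef_tdir hRs hRp]
    simp
  rw [tcoef_const_mul] at h1
  have h2 : (μ : ℂ) ≠ 0 := by exact_mod_cast hμ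
  exact (mul_eq_zero.1 h1).resolve_left h2

end FinalPart
open Real Filter

/-- **Persistence of invariant tori.** Under (H1), for `μ` small there are smooth
periodic functions `a^μ, Q^μ, P^μ = O(μ)` such that for every `I₀` and every `A` the
curve `t ↦ (ωt + A, I₀ + a^μ(ωt + A), Q^μ(ωt + A), P^μ(ωt + A))` solves the equations of
motion `φ̇ = ω`, `İ = -μ ∂_φ f(φ,q)`, `q̇ = p`, `ṗ = sin q - μ ∂_q f(φ,q)`.  In
particular each torus `T^μ_{I₀}` is invariant, carrying the rotation of speed `ω`. -/
theorem persistence_of_invariant_tori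
    (n : ℕ) (ω : Fin n → ℝ) (γ τ : ℝ) (hγ : 0 < γ) (hτ : (n : ℝ) < τ)
    (hH1 : ∀ k : Fin n → ℤ, k ≠ 0 →
      γ / ‖(fun i => (k i : ℝ))‖ ^ τ ≤ |∑ i, (k i : ℝ) * ω i|)
    (f : (Fin n → ℝ) × ℝ → ℝ) (hf : ContDiff ℝ (⊤ : ℕ∞) f)
    (hper : ∀ (k : Fin n → ℤ) (m : ℤ) (x : Fin n → ℝ) (y : ℝ),
      f (x + fun i => 2 * Real.pi * (k i : ℝ), y + 2 * Real.pi * (m : ℝ)) = f (x, y)) :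
    ∃ μ0 > (0:ℝ), ∃ C > (0:ℝ), ∀ μ : ℝ, |μ| < μ0 →
      ∃ (a : (Fin n → ℝ) → Fin n → ℝ) (Q P : (Fin n → ℝ) → ℝ),
        ContDiff ℝ (⊤ : ℕ∞) a ∧ ContDiff ℝ (⊤ : ℕ∞) Q ∧ ContDiff ℝ (⊤ : ℕ∞) P ∧
        (∀ (k : Fin n → ℤ) (ψ : Fin n → ℝ),
          a (ψ + fun i => 2 * Real.pi * (k i : ℝ)) = a ψ ∧
          Q (ψ + fun i => 2 * Real.pi * (k i : ℝ)) = Q ψ ∧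
          P (ψ + fun i => 2 * Real.pi * (k i : ℝ)) = P ψ) ∧
        (∀ ψ : Fin n → ℝ, ‖a ψ‖ ≤ C * |μ| ∧ |Q ψ| ≤ C * |μ| ∧ |P ψ| ≤ C * |μ|) ∧
        ∀ (I0 A : Fin n → ℝ),
          let φ : ℝ → Fin n → ℝ := fun t => fun i => ω i * t + A i
          let I : ℝ → Fin n → ℝ := fun t => I0 + a (φ t)
          let qq : ℝ → ℝ := fun t => Q (φ t)
          let pp : ℝ → ℝ := fun t => P (φ t)
          ∀ t : ℝ,
            HasDerivAt φ ω t ∧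
            HasDerivAt I
              ((-μ) • fun i => fderiv ℝ f (φ t, qq t) (Pi.single i 1, 0)) t ∧
            HasDerivAt qq (pp t) t ∧
            HasDerivAt pp
              (Real.sin (qq t) - μ * fderiv ℝ f (φ t, qq t) (0, 1)) t := by
  have hfn : VNice f := ⟨hf, hper⟩
  have hgn : ∀ v : (Fin n → ℝ) × ℝ, VNice (fun p => fderiv ℝ f p v) := fun v =>
    ⟨hfn.fderiv.smooth.clm_apply contDiff_const, fun k m x y => by
      simp only [hfn.fderiv.per k m x y]⟩
  obtain ⟨δ, hδ, Q, hQs, hQp, hQ0, hode⟩ := exists_Qs ω _ (hgn (0, 1))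
  have hPs := jd_contDiff hQs (0, ω)
  have hPp := hQp.jd (0, ω)
  have hP0 : ∀ θ, jd (0, ω) Q (0, θ) = 0 := by
    intro θ
    have h1 := congrFun (jd_slice hQs ω 0) θ
    rw [← h1]
    simp [tdir, hQ0]
  obtain ⟨C1, hC1, hQb⟩ := hQp.linear_bound hQs hQ0
  obtain ⟨C2, hC2, hPb⟩ := hPp.linear_bound hPs hP0
  obtain ⟨m, K, hK, hcoh⟩ := cohom n ω γ τ hγ hH1
  set G : Fin n → ℝ × (Fin n → ℝ) → ℝ := fun i z =>
    fderiv ℝ f (z.2, Q z) (Pi.single i 1, 0) with hG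
  have hGs : ∀ i, ContDiff ℝ (⊤ : ℕ∞) (G i) := fun i =>
    (hgn (Pi.single i 1, 0)).smooth.comp (contDiff_snd.prodMk hQs)
  have hGp : ∀ i, JPer (G i) := by
    intro i k z
    have h1 := (hgn (Pi.single i 1, 0)).per k 0 z.2 (Q z)
    simp only [Int.cast_zero, mul_zero, add_zero] at h1
    simp only [hG, hQp k z, Prod.snd_add]
    exact h1
  have hGb : ∀ i j : Fin n, ∃ M : ℝ, 0 ≤ M ∧ ∀ μ θ, |μ| ≤ 1 →
      |(jd (0, Pi.single j 1))^[m] (G i) (μ, θ)| ≤ M := fun i j =>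
    (jd_iter (hGs i) (hGp i) (Pi.single j 1) m).2.1.bounded
      (jd_iter (hGs i) (hGp i) (Pi.single j 1) m).1.continuous
  choose M hM0 hM using hGb
  set MM : ℝ := ∑ i, ∑ j, M i j with hMM
  have hMM0 : 0 ≤ MM := Finset.sum_nonneg fun i _ => Finset.sum_nonneg fun j _ => hM0 i j
  have hMle : ∀ i j, M i j ≤ MM := by
    intro i j
    have h1 : M i j ≤ ∑ j, M i j :=
      Finset.single_le_sum (f := fun j => M i j) (fun j _ => hM0 i j) (Finset.mem_univ j)
    have h2 : ∑ j, M i j ≤ MM :=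
      Finset.single_le_sum (f := fun i => ∑ j, M i j)
        (fun i _ => Finset.sum_nonneg fun j _ => hM0 i j) (Finset.mem_univ i)
    exact h1.trans h2
  refine ⟨min δ 1, lt_min hδ one_pos, C1 + C2 + K * MM + 1, by positivity, ?_⟩
  intro μ hμ
  have hμδ : |μ| < δ := hμ.trans_le (min_le_left _ _)
  have hμ1 : |μ| ≤ 1 := (hμ.trans_le (min_le_right _ _)).le
  have hqs : ContDiff ℝ (⊤ : ℕ∞) (fun θ => Q (μ, θ)) := hQs.comp (contDiff_prodMk_right μ)
  have hex : ∀ i : Fin n, ∃ a : (Fin n → ℝ) → ℝ, ContDiff ℝ (⊤ : ℕ∞) a ∧ TPer a ∧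
      (∀ x, |a x| ≤ K * MM * |μ|) ∧
      ∀ (A : Fin n → ℝ) (t : ℝ), HasDerivAt (fun t : ℝ => a (A + t • ω))
        (-μ * G i (μ, A + t • ω)) t := by
    intro i
    by_cases h0 : μ = 0
    · refine ⟨fun _ => 0, contDiff_const, fun _ _ => rfl, fun x => ?_, fun A t => ?_⟩
      · simp [h0]
      · rw [h0, neg_zero, zero_mul]
        exact hasDerivAt_const t 0
    · have hz : tcoef (fun θ => G i (μ, θ)) 0 = 0 :=
        mean_zero ω (Pi.single i 1) f hfn μ h0 (fun θ => Q (μ, θ)) hqs (hQp.slice μ)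
          (hode μ hμδ)
      obtain ⟨b, hb1, hb2, hb3, hb4⟩ := hcoh (fun θ => G i (μ, θ))
        ((hGs i).comp (contDiff_prodMk_right μ)) ((hGp i).slice μ) hz MM hMM0
        (fun j x => by
          rw [(jd_iter (hGs i) (hGp i) (Pi.single j 1) m).2.2 μ]
          exact (hM i j μ x hμ1).trans (hMle i j))
      refine ⟨fun x => -μ * b x, contDiff_const.mul hb1, fun k x => ?_, fun x => ?_,
        fun A t => (hb4 A t).const_mul (-μ)⟩
      · simp only [hb2 k x]
      · rw [abs_mul, abs_neg, mul_comm]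
        exact mul_le_mul_of_nonneg_right (hb3 x) (abs_nonneg μ)
  choose a ha1 ha2 ha3 ha4 using hex
  have hKM : 0 ≤ K * MM := by positivity
  have hμ0 := abs_nonneg μ
  refine ⟨fun ψ i => a i ψ, fun θ => Q (μ, θ), fun θ => jd (0, ω) Q (μ, θ),
    contDiff_pi.2 ha1, hqs, hPs.comp (contDiff_prodMk_right μ), ?_, ?_, ?_⟩
  · intro k ψ
    exact ⟨funext fun i => ha2 i k ψ, hQp.slice μ k ψ, hPp.slice μ k ψ⟩
  · intro ψ
    have w1 := mul_nonneg hC1 hμ0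
    have w2 := mul_nonneg hC2 hμ0
    have w3 := mul_nonneg hKM hμ0
    refine ⟨(pi_norm_le_iff_of_nonneg (by positivity)).2 fun i => (ha3 i ψ).trans ?_,
      (hQb μ ψ hμ1).trans ?_, (hPb μ ψ hμ1).trans ?_⟩ <;> nlinarith
  · intro I0 A φ I qq pp t
    have hφ : φ = fun t : ℝ => A + t • ω := by
      funext t i
      simp only [φ, Pi.add_apply, Pi.smul_apply, smul_eq_mul]
      ring
    have hPeq : (fun θ => jd (0, ω) Q (μ, θ)) = tdir ω (fun θ => Q (μ, θ)) :=
      (jd_slice hQs ω μ).symm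
    refine ⟨?_, ?_, ?_, ?_⟩
    · rw [hφ]
      simpa using ((hasDerivAt_id t).smul_const ω).const_add A
    · refine HasDerivAt.const_add I0 ?_
      rw [hasDerivAt_pi]
      intro i
      have h1 := ha4 i A t
      simp only [qq, hφ]
      exact h1
    · have h1 := tdir_hasDerivAt hqs ω A t
      rw [← hPeq] at h1
      simp only [qq, pp, hφ]
      exact h1
    · have h1 := tdir_hasDerivAt (tdir_contDiff hqs ω) ω A t
      rw [hode μ hμδ, ← hPeq] at h1
      simp only [qq, pp, hφ]
      exact h1
end
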